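/- Let Γ be a distance-regular graph with classical parameters (D, b, α, β) such that b ≥ 2 and D ≥ 3, and let r = [D]. If β ≥ (1/3)(8αb + 8b + 5α)r, then Γ has the SPLS(⌊4r/3⌋) property; in particular, in this case α is an integer with 0 ≤ α ≤ b. -/

import Mathlib

open SimpleGraph

namespace DRGPaper

variable {V : Type*}

/-- `Γ` is a distance-regular graph with diameter `D` and intersection arrays `cc`, `aa`, `bb`:
`Γ` is connected of diameter `D` and for any vertices `x, y` at distance `i ≤ D`, `y` has exactly
`cc i` neighbours at distance `i - 1` from `x`, `aa i` neighbours at distance `i` from `x`,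
and `bb i` neighbours at distance `i + 1` from `x`. -/
def IsDRG [Fintype V] (G : SimpleGraph V) (D : ℕ) (cc aa bb : ℕ → ℕ) : Prop :=
  G.Connected ∧
  (∀ x y : V, G.dist x y ≤ D) ∧
  (∃ x y : V, G.dist x y = D) ∧
  ∀ i : ℕ, i ≤ D → ∀ x y : V, G.dist x y = i →
    {z : V | G.Adj y z ∧ G.dist x z = i - 1}.ncard = cc i ∧
    {z : V | G.Adj y z ∧ G.dist x z = i}.ncard = aa i ∧
    {z : V | G.Adj y z ∧ G.dist x z = i + 1}.ncard = bb i

/-- `[j] = (b^j - 1)/(b - 1) = 1 + b + ⋯ + b^(j-1)` as a real number. -/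
def gauss (b j : ℕ) : ℝ := ∑ i ∈ Finset.range j, (b : ℝ) ^ i

/-- `Γ` has classical parameters `(D, b, α, β)`: it is distance-regular of diameter `D` with
`bb i = ([D] - [i])(β - α[i])` for `0 ≤ i ≤ D - 1` and `cc i = [i](1 + α[i-1])` for
`1 ≤ i ≤ D`. -/
def HasClassicalParams [Fintype V] (G : SimpleGraph V) (D b : ℕ) (α β : ℝ)
    (cc aa bb : ℕ → ℕ) : Prop :=
  IsDRG G D cc aa bb ∧
  (∀ i : ℕ, i ≤ D - 1 → (bb i : ℝ) = (gauss b D - gauss b i) * (β - α * gauss b i)) ∧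
  (∀ i : ℕ, 1 ≤ i → i ≤ D → (cc i : ℝ) = gauss b i * (1 + α * gauss b (i - 1)))

/-- `d(x, C) = min {d(x, y) : y ∈ C}`. -/
noncomputable def distToSet (G : SimpleGraph V) (x : V) (C : Set V) : ℕ :=
  sInf (G.dist x '' C)

/-- A maximal clique of `G`. -/
def IsMaxClique (G : SimpleGraph V) (s : Set V) : Prop :=
  G.IsClique s ∧ ∀ t : Set V, G.IsClique t → s ⊆ t → t = s

/-- The lines for the PLS(γ) property: maximal cliques with at least `γ` vertices. -/
def plsLines (G : SimpleGraph V) (γ : ℕ) : Set (Set V) :=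
  {ℓ : Set V | IsMaxClique G ℓ ∧ γ ≤ ℓ.ncard}

/-- `G` is the point graph of the partial linear space with line set `L`: any two adjacent
vertices lie on exactly one common line of `L`. -/
def IsPointGraphOf (G : SimpleGraph V) (L : Set (Set V)) : Prop :=
  ∀ x y : V, G.Adj x y → ∃! ℓ : Set V, ℓ ∈ L ∧ x ∈ ℓ ∧ y ∈ ℓ

/-- A vertex is a Delsarte vertex (w.r.t. the line set `L` and classical parameter `β`) if all
lines through it have exactly `β + 1` vertices. -/
def IsDelsarteVertex (L : Set (Set V)) (β : ℝ) (x : V) : Prop :=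
  ∀ ℓ ∈ L, x ∈ ℓ → (ℓ.ncard : ℝ) = β + 1

/-- The lines for the SPLS(c, s) property: maximal cliques with at least
`a1 + 2 - (c - 1)(s - 1)` vertices. -/
def splsLines (G : SimpleGraph V) (a1 c s : ℕ) : Set (Set V) :=
  {ℓ : Set V | IsMaxClique G ℓ ∧ (a1 : ℤ) + 2 - ((c : ℤ) - 1) * ((s : ℤ) - 1) ≤ (ℓ.ncard : ℤ)}

/-- The SPLS(c, s) property: `G` is the point graph of the partial linear space whose lines are
the maximal cliques with at least `a1 + 2 - (c-1)(s-1)` vertices, `a1 ≥ (2s-1)(c-1)`, each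
vertex lies on at most `s` lines, and every point not on a line `ℓ` is collinear with at most
`c` points of `ℓ`.  SPLS(s) is the case `c = c₂`. -/
def HasSPLS (G : SimpleGraph V) (a1 c s : ℕ) : Prop :=
  1 ≤ c ∧ 2 ≤ s ∧
  (2 * (s : ℤ) - 1) * ((c : ℤ) - 1) ≤ (a1 : ℤ) ∧
  IsPointGraphOf G (splsLines G a1 c s) ∧
  (∀ x : V, {ℓ ∈ splsLines G a1 c s | x ∈ ℓ}.ncard ≤ s) ∧
  (∀ ℓ ∈ splsLines G a1 c s, ∀ x : V, x ∉ ℓ → {y ∈ ℓ | G.Adj x y}.ncard ≤ c)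

/-- `[x, y]`: the set of lines `ℓ ∈ L` through `x` such that `d(y, u) ≤ 2` for all `u ∈ ℓ`. -/
def lineXY (G : SimpleGraph V) (L : Set (Set V)) (x y : V) : Set (Set V) :=
  {ℓ ∈ L | x ∈ ℓ ∧ ∀ u ∈ ℓ, G.dist y u ≤ 2}

/-- `𝓒` witnesses that `G` is geometric with cliques of order `q`: every member of `𝓒` is a
clique with exactly `q` vertices and every edge of `G` lies in a unique member of `𝓒`. -/
def IsGeomLineSet (G : SimpleGraph V) (q : ℝ) (𝓒 : Set (Set V)) : Prop :=
  (∀ C ∈ 𝓒, G.IsClique C ∧ (C.ncard : ℝ) = q) ∧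
  ∀ x y : V, G.Adj x y → ∃! C : Set V, C ∈ 𝓒 ∧ x ∈ C ∧ y ∈ C

/-- `G` is geometric: there is a set of Delsarte cliques (cliques of the maximum order `q`)
such that every edge lies in a unique member. -/
def IsGeometric (G : SimpleGraph V) (q : ℝ) : Prop :=
  ∃ 𝓒 : Set (Set V), IsGeomLineSet G q 𝓒

/-- An assembly: a maximal clique which is not a line. -/
def IsAssembly (G : SimpleGraph V) (𝓒 : Set (Set V)) (M : Set V) : Prop :=
  IsMaxClique G M ∧ M ∉ 𝓒

/-- The dual Pasch axiom: for every pair of adjacent vertices `x, y`, the common neighbours of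
`x` and `y` outside the (any) line of `𝓒` through `x` and `y` form a clique. -/
def DualPasch (G : SimpleGraph V) (𝓒 : Set (Set V)) : Prop :=
  ∀ x y : V, G.Adj x y → ∀ ℓ ∈ 𝓒, x ∈ ℓ → y ∈ ℓ →
    G.IsClique {z : V | G.Adj x z ∧ G.Adj y z ∧ z ∉ ℓ}

/-- The `m × n` grid, i.e. the Cartesian product `K_m □ K_n`. -/
def gridGraph (m n : ℕ) : SimpleGraph (Fin m × Fin n) :=
  (⊤ : SimpleGraph (Fin m)).boxProd (⊤ : SimpleGraph (Fin n))

/-- The `A`-clique extension of a graph `H`: replace every vertex of `H` by a clique of size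
`A`, vertices in distinct cliques being adjacent exactly when the underlying vertices of `H`
are adjacent. -/
def cliqueExt {W : Type*} (H : SimpleGraph W) (A : ℕ) : SimpleGraph (W × Fin A) :=
  SimpleGraph.fromRel (fun p q => H.Adj p.1 q.1 ∨ p.1 = q.1)

/-- `θ` is an eigenvalue of the adjacency matrix of `G`. -/
def IsAdjEigenvalue [Fintype V] (G : SimpleGraph V) [DecidableRel G.Adj] (θ : ℝ) : Prop :=
  ∃ v : V → ℝ, v ≠ 0 ∧ (G.adjMatrix ℝ).mulVec v = θ • v

section CliqueGeometry

/-- Twice the Bonferroni lower bound for the union of finitely many sets of size at least `n`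
with pairwise intersections of size at most `t`. -/
theorem bonferroni_card_biUnion {ι : Type*} [DecidableEq ι] [DecidableEq V] (S : Finset ι)
    (B : ι → Finset V) (n t : ℤ) (hn : ∀ i ∈ S, n ≤ (B i).card)
    (ht : ∀ i ∈ S, ∀ j ∈ S, i ≠ j → ((B i ∩ B j).card : ℤ) ≤ t) :
    2 * (S.card : ℤ) * n - S.card * (S.card - 1) * t ≤ 2 * (S.biUnion B).card := by
  induction S using Finset.induction_on with
  | empty => simp
  | insert a S ha ih =>
    have ih' := ih (fun i hi => hn i (Finset.mem_insert_of_mem hi))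
      (fun i hi j hj => ht i (Finset.mem_insert_of_mem hi) j (Finset.mem_insert_of_mem hj))
    have hinter : ((B a ∩ S.biUnion B).card : ℤ) ≤ S.card * t := by
      rw [Finset.inter_biUnion]
      calc ((S.biUnion fun i => B a ∩ B i).card : ℤ) ≤ ∑ i ∈ S, ((B a ∩ B i).card : ℤ) := by
            exact_mod_cast Finset.card_biUnion_le
        _ ≤ ∑ _i ∈ S, t := Finset.sum_le_sum fun i hi =>
            ht a (Finset.mem_insert_self _ _) i (Finset.mem_insert_of_mem hi)
              (fun h => ha (h ▸ hi))
        _ = S.card * t := by simp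
    have hunion := Finset.card_union_add_card_inter (B a) (S.biUnion B)
    have hna := hn a (Finset.mem_insert_self _ _)
    rw [Finset.biUnion_insert, Finset.card_insert_of_notMem ha]
    push_cast
    zify at hunion
    linarith

theorem IsMaxClique.exists_not_adj {G : SimpleGraph V} {ℓ : Set V}
    (hℓ : IsMaxClique G ℓ) {x : V} (hx : x ∉ ℓ) :
    ∃ u ∈ ℓ, u ≠ x ∧ ¬ G.Adj x u := by
  by_contra! hcon
  have hcl : G.IsClique (insert x ℓ) :=
    hℓ.1.insert fun u hu hne => hcon u hu hne.symm
  exact hx (hℓ.2 _ hcl (Set.subset_insert _ _) ▸ Set.mem_insert _ _)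

/-- Parameter conditions on a finite regular graph of valency `k` in which adjacent vertices have
`lam` common neighbours and non-adjacent ones at most `mu`; they force the large maximal cliques
to form a partial linear space with at most `s` lines on each point. -/
structure LargeCliqueHyp [Fintype V] (G : SimpleGraph V) (k lam mu s : ℕ) : Prop where
  degree : ∀ x, {z | G.Adj x z}.ncard = k
  adj_common : ∀ x y, G.Adj x y → {z | G.Adj x z ∧ G.Adj y z}.ncard = lam
  nonadj_common : ∀ x y, x ≠ y → ¬ G.Adj x y → {z | G.Adj x z ∧ G.Adj y z}.ncard ≤ mu
  one_le_mu : 1 ≤ mu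
  one_le_s : 1 ≤ s
  lam_bound : (2 * (s : ℤ) - 1) * ((mu : ℤ) - 1) ≤ lam
  valency_bound : 2 * (k : ℤ) < 2 * (s + 1) * (lam + 1) - s * (s + 1) * (mu - 1)

variable [Fintype V] {G : SimpleGraph V} {k lam mu s : ℕ}

theorem exists_isMaxClique_superset {t : Set V} (ht : G.IsClique t) :
    ∃ ℓ, IsMaxClique G ℓ ∧ t ⊆ ℓ := by
  obtain ⟨ℓ, hle, hmax⟩ := Finite.exists_le_maximal (p := fun u : Set V => G.IsClique u) ht
  exact ⟨ℓ, ⟨hmax.prop, fun u hu hsub => (hmax.eq_of_subset hu hsub).symm⟩, hle⟩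

theorem LargeCliqueHyp.ncard_adj_le (H : LargeCliqueHyp G k lam mu s) {ℓ : Set V}
    (hℓ : IsMaxClique G ℓ) {x : V} (hx : x ∉ ℓ) : {y ∈ ℓ | G.Adj x y}.ncard ≤ mu := by
  obtain ⟨u, hu, hne, hadj⟩ := hℓ.exists_not_adj hx
  refine (Set.ncard_le_ncard ?_).trans (H.nonadj_common x u hne.symm hadj)
  rintro y ⟨hy, hxy⟩
  refine ⟨hxy, hℓ.1 hu hy ?_⟩
  rintro rfl
  exact hadj hxy

theorem LargeCliqueHyp.line_unique (H : LargeCliqueHyp G k lam mu s) {ℓ ℓ' : Set V}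
    (hℓ : ℓ ∈ splsLines G lam mu s) (hℓ' : ℓ' ∈ splsLines G lam mu s) {x p : V} (hne : x ≠ p)
    (hx : x ∈ ℓ) (hx' : x ∈ ℓ') (hp : p ∈ ℓ) (hp' : p ∈ ℓ') : ℓ = ℓ' := by
  by_contra hneq
  have hnsub : ¬ ℓ ⊆ ℓ' := fun hsub => hneq (hℓ.1.2 _ hℓ'.1.1 hsub).symm
  obtain ⟨u, hu, hu'⟩ := Set.not_subset.1 hnsub
  have hinter : (ℓ ∩ ℓ').ncard ≤ mu := by
    refine (Set.ncard_le_ncard ?_).trans (H.ncard_adj_le hℓ'.1 hu')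
    rintro y ⟨hy, hy'⟩
    exact ⟨hy', hℓ.1.1 hu hy fun h => hu' (h ▸ hy')⟩
  have hunion : (ℓ ∪ ℓ').ncard ≤ lam + 2 := by
    have hsub : ℓ ∪ ℓ' ⊆ {z | G.Adj x z ∧ G.Adj p z} ∪ {x, p} := by
      intro y hy
      by_cases hyx : y = x
      · simp [hyx]
      by_cases hyp : y = p
      · simp [hyp]
      left
      rcases hy with hy | hy
      · exact ⟨hℓ.1.1 hx hy (Ne.symm hyx), hℓ.1.1 hp hy (Ne.symm hyp)⟩
      · exact ⟨hℓ'.1.1 hx' hy (Ne.symm hyx), hℓ'.1.1 hp' hy (Ne.symm hyp)⟩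
    calc (ℓ ∪ ℓ').ncard ≤ _ := Set.ncard_le_ncard hsub
      _ ≤ _ := Set.ncard_union_le _ _
      _ = lam + 2 := by rw [H.adj_common x p (hℓ.1.1 hx hp hne), Set.ncard_pair hne]
  have hsum := Set.ncard_union_add_ncard_inter ℓ ℓ'
  have h1 := hℓ.2
  have h2 := hℓ'.2
  have h3 := H.lam_bound
  zify at hsum hinter hunion
  linarith

theorem LargeCliqueHyp.card_coclique_le (H : LargeCliqueHyp G k lam mu s) {x : V} {S : Finset V}
    (hS : ∀ z ∈ S, G.Adj x z) (hind : ∀ z ∈ S, ∀ w ∈ S, ¬ G.Adj z w) : S.card ≤ s := by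
  classical
  by_contra! hcard
  obtain ⟨T, hTS, hT⟩ := Finset.exists_subset_card_eq (Nat.succ_le_of_lt hcard)
  let B : V → Finset V := fun z => insert z {w | G.Adj x w ∧ G.Adj z w}.toFinset
  have hB : ∀ z ∈ T, ((lam : ℤ) + 1) ≤ (B z).card := by
    intro z hz
    have h1 := H.adj_common x z (hS z (hTS hz))
    rw [Set.ncard_eq_toFinset_card'] at h1
    rw [Finset.card_insert_of_notMem (by simp), h1]
    push_cast
    rfl
  have hBB : ∀ z ∈ T, ∀ w ∈ T, z ≠ w → ((B z ∩ B w).card : ℤ) ≤ mu - 1 := by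
    intro z hz w hw hne
    have h1 := H.nonadj_common z w hne (hind z (hTS hz) w (hTS hw))
    rw [Set.ncard_eq_toFinset_card'] at h1
    have hsub : insert x (B z ∩ B w) ⊆ {y | G.Adj z y ∧ G.Adj w y}.toFinset := by
      intro y hy
      have hxz := hS z (hTS hz)
      have hxw := hS w (hTS hw)
      have hzw := hind z (hTS hz) w (hTS hw)
      have hwz := hind w (hTS hw) z (hTS hz)
      simp only [B, Finset.mem_insert, Finset.mem_inter, Set.mem_toFinset, Set.mem_ofPred_eq]
        at hy ⊢
      rcases hy with rfl | ⟨rfl | h3, rfl | h4⟩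
      · exact ⟨hxz.symm, hxw.symm⟩
      · exact absurd rfl hne
      · exact absurd h4.2 hwz
      · exact absurd h3.2 hzw
      · exact ⟨h3.2, h4.2⟩
    have h2 := Finset.card_le_card hsub
    rw [Finset.card_insert_of_notMem (by simp [B, (hS z (hTS hz)).ne])] at h2
    zify at h1 h2
    linarith
  have hbon := bonferroni_card_biUnion T B _ _ hB hBB
  have hle : ((T.biUnion B).card : ℤ) ≤ k := by
    have h1 := H.degree x
    rw [Set.ncard_eq_toFinset_card'] at h1
    rw [← h1]
    norm_cast
    refine Finset.card_le_card fun y hy => ?_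
    simp only [B, Finset.mem_biUnion, Finset.mem_insert, Set.mem_toFinset, Set.mem_ofPred_eq]
      at hy ⊢
    obtain ⟨z, hz, rfl | h2⟩ := hy
    · exact hS _ (hTS hz)
    · exact h2.1
  have hval := H.valency_bound
  rw [hT] at hbon
  push_cast at hbon
  linarith

/-- A coclique in the neighbourhood of `x` extends greedily along lines through `x`. -/
theorem LargeCliqueHyp.exists_coclique (H : LargeCliqueHyp G k lam mu s) {x : V}
    (F : Finset (Set V)) (S : Finset V)
    (hF : ∀ ℓ ∈ F, ℓ ∈ splsLines G lam mu s ∧ x ∈ ℓ)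
    (hS : ∀ z ∈ S, G.Adj x z) (hind : ∀ z ∈ S, ∀ w ∈ S, ¬ G.Adj z w)
    (hSF : ∀ z ∈ S, ∀ ℓ ∈ F, z ∉ ℓ) (hcard : F.card + S.card ≤ s + 1) :
    ∃ T : Finset V, (∀ z ∈ T, G.Adj x z) ∧ (∀ z ∈ T, ∀ w ∈ T, ¬ G.Adj z w) ∧
      T.card = F.card + S.card := by
  classical
  induction F using Finset.induction_on generalizing S with
  | empty => exact ⟨S, hS, hind, by simp⟩
  | insert ℓ F hℓF ih =>
    obtain ⟨hℓ, hxℓ⟩ := hF ℓ (Finset.mem_insert_self _ _)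
    rw [Finset.card_insert_of_notMem hℓF] at hcard
    have hmu := H.one_le_mu
    have hw : ∃ w ∈ ℓ, w ≠ x ∧ ∀ z ∈ S, ¬ G.Adj z w := by
      by_contra! hcon
      have hsub : (ℓ \ {x}).toFinset ⊆
          S.biUnion fun z => ({y ∈ ℓ | G.Adj z y} \ {x}).toFinset := by
        intro w hw
        simp only [Set.mem_toFinset, Set.mem_sdiff, Set.mem_singleton_iff] at hw
        obtain ⟨z, hz, hzw⟩ := hcon w hw.1 hw.2
        simp only [Finset.mem_biUnion, Set.mem_toFinset]
        exact ⟨z, hz, ⟨hw.1, hzw⟩, hw.2⟩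
      have h1 := (Finset.card_le_card hsub).trans Finset.card_biUnion_le
      have h2 : ∀ z ∈ S, ({y ∈ ℓ | G.Adj z y} \ {x}).toFinset.card ≤ mu - 1 := by
        intro z hz
        have hx : x ∈ {y ∈ ℓ | G.Adj z y} := ⟨hxℓ, (hS z hz).symm⟩
        rw [← Set.ncard_eq_toFinset_card', Set.ncard_sdiff_singleton_of_mem hx]
        exact Nat.sub_le_sub_right
          (H.ncard_adj_le hℓ.1 (hSF z hz ℓ (Finset.mem_insert_self _ _))) 1
      have h3 := h1.trans (Finset.sum_le_card_nsmul _ _ _ h2)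
      rw [← Set.ncard_eq_toFinset_card', smul_eq_mul] at h3
      have h4 := Set.ncard_sdiff_singleton_add_one hxℓ
      have h5 := hℓ.2
      have h6 := H.lam_bound
      have h7 : S.card * (mu - 1) ≤ s * (mu - 1) := Nat.mul_le_mul_right _ (by omega)
      zify [hmu] at h3 h4 h7
      linarith
    obtain ⟨w, hwℓ, hwx, hwS⟩ := hw
    have hxw : G.Adj x w := hℓ.1.1 hxℓ hwℓ hwx.symm
    have hwnS : w ∉ S := fun h => hSF w h ℓ (Finset.mem_insert_self _ _) hwℓ
    obtain ⟨T, hT1, hT2, hT3⟩ := ih (insert w S)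
      (fun m hm => hF m (Finset.mem_insert_of_mem hm))
      (by
        intro z hz
        rcases Finset.mem_insert.1 hz with rfl | hz
        exacts [hxw, hS z hz])
      (by
        intro z hz y hy
        rcases Finset.mem_insert.1 hz with rfl | hz' <;>
          rcases Finset.mem_insert.1 hy with rfl | hy'
        · exact G.irrefl
        · exact fun h => hwS y hy' h.symm
        · exact hwS z hz'
        · exact hind z hz' y hy')
      (by
        intro z hz m hm
        rcases Finset.mem_insert.1 hz with rfl | hz
        · intro hzm
          obtain ⟨hm1, hm2⟩ := hF m (Finset.mem_insert_of_mem hm)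
          exact hℓF (H.line_unique hℓ hm1 hwx hwℓ hzm hxℓ hm2 ▸ hm)
        · exact hSF z hz m (Finset.mem_insert_of_mem hm))
      (by rw [Finset.card_insert_of_notMem hwnS]; omega)
    refine ⟨T, hT1, hT2, ?_⟩
    rw [hT3, Finset.card_insert_of_notMem hwnS, Finset.card_insert_of_notMem hℓF]
    omega

/-- Every member of a maximum coclique in the neighbourhood of `x` is on a line with `x`. -/
theorem LargeCliqueHyp.exists_line_of_maximum (H : LargeCliqueHyp G k lam mu s) {x : V}
    {S : Finset V} (hS : ∀ z ∈ S, G.Adj x z) (hind : ∀ z ∈ S, ∀ w ∈ S, ¬ G.Adj z w)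
    (hmax : ∀ T : Finset V, (∀ z ∈ T, G.Adj x z) → (∀ z ∈ T, ∀ w ∈ T, ¬ G.Adj z w) →
      T.card ≤ S.card) {z : V} (hz : z ∈ S) :
    ∃ ℓ ∈ splsLines G lam mu s, x ∈ ℓ ∧ z ∈ ℓ := by
  classical
  have hmu := H.one_le_mu
  have hSs := H.card_coclique_le hS hind
  have hxz := hS z hz
  let P : Set V := {w | G.Adj x w ∧ G.Adj z w ∧ ∀ y ∈ S, y ≠ z → ¬ G.Adj y w}
  have hPnS : ∀ w ∈ P, w ∉ S := fun w hw hwS => hind z hz w hwS hw.2.1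
  have hPcl : G.IsClique P := by
    intro v hv w hw hvw
    by_contra hadj
    have hle := hmax (insert v (insert w (S.erase z)))
      (by
        intro y hy
        simp only [Finset.mem_insert, Finset.mem_erase] at hy
        rcases hy with rfl | rfl | hy
        exacts [hv.1, hw.1, hS y hy.2])
      (by
        intro y hy y' hy'
        simp only [Finset.mem_insert, Finset.mem_erase] at hy hy'
        rcases hy with rfl | rfl | hy <;> rcases hy' with rfl | rfl | hy'
        · exact G.irrefl
        · exact hadj
        · exact fun h => hv.2.2 _ hy'.2 hy'.1 h.symm
        · exact fun h => hadj h.symm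
        · exact G.irrefl
        · exact fun h => hw.2.2 _ hy'.2 hy'.1 h.symm
        · exact hv.2.2 _ hy.2 hy.1
        · exact hw.2.2 _ hy.2 hy.1
        · exact hind _ hy.2 _ hy'.2)
    have hwn : w ∉ S.erase z := fun h => hPnS w hw (Finset.mem_of_mem_erase h)
    have hvn : v ∉ insert w (S.erase z) := by
      rw [Finset.mem_insert, not_or]
      exact ⟨hvw, fun h => hPnS v hv (Finset.mem_of_mem_erase h)⟩
    rw [Finset.card_insert_of_notMem hvn, Finset.card_insert_of_notMem hwn,
      Finset.card_erase_of_mem hz] at hle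
    have := Finset.card_pos.2 ⟨z, hz⟩
    omega
  have hcl : G.IsClique (insert x (insert z P)) := by
    refine (hPcl.insert fun w hw _ => hw.2.1).insert ?_
    intro w hw _
    rcases hw with rfl | hw
    exacts [hxz, hw.1]
  have hxn : x ∉ insert z P := by
    rintro (h | h)
    exacts [hxz.ne h, G.irrefl h.1]
  have hzn : z ∉ P := fun h => G.irrefl h.2.1
  have hcard : lam ≤ P.ncard + (S.card - 1) * (mu - 1) := by
    have hsub : {w | G.Adj x w ∧ G.Adj z w}.toFinset ⊆ P.toFinset ∪
        (S.erase z).biUnion fun y => ({w | G.Adj z w ∧ G.Adj y w} \ {x}).toFinset := by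
      intro w hw
      rw [Set.mem_toFinset] at hw
      rw [Finset.mem_union, Set.mem_toFinset]
      by_cases hP : w ∈ P
      · exact Or.inl hP
      · right
        have : ∃ y ∈ S, y ≠ z ∧ G.Adj y w := by
          by_contra! hcon
          exact hP ⟨hw.1, hw.2, hcon⟩
        obtain ⟨y, hy, hyz, hyw⟩ := this
        simp only [Finset.mem_biUnion, Set.mem_toFinset]
        exact ⟨y, Finset.mem_erase.2 ⟨hyz, hy⟩, ⟨hw.2, hyw⟩, hw.1.ne'⟩
    have h1 := (Finset.card_le_card hsub).trans ((Finset.card_union_le _ _).trans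
      (Nat.add_le_add_left Finset.card_biUnion_le _))
    have h2 : ∀ y ∈ S.erase z,
        ({w | G.Adj z w ∧ G.Adj y w} \ {x}).toFinset.card ≤ mu - 1 := by
      intro y hy
      obtain ⟨hyz, hyS⟩ := Finset.mem_erase.1 hy
      have hx : x ∈ {w | G.Adj z w ∧ G.Adj y w} := ⟨hxz.symm, (hS y hyS).symm⟩
      rw [← Set.ncard_eq_toFinset_card', Set.ncard_sdiff_singleton_of_mem hx]
      exact Nat.sub_le_sub_right (H.nonadj_common z y hyz.symm (hind z hz y hyS)) 1
    have h3 := Finset.sum_le_card_nsmul _ _ _ h2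
    rw [Finset.card_erase_of_mem hz, smul_eq_mul] at h3
    rw [← Set.ncard_eq_toFinset_card', H.adj_common x z hxz, ← Set.ncard_eq_toFinset_card'] at h1
    omega
  obtain ⟨ℓ, hℓ, hsub⟩ := exists_isMaxClique_superset hcl
  refine ⟨ℓ, ⟨hℓ, ?_⟩, hsub (by simp), hsub (by simp)⟩
  have h1 := Set.ncard_le_ncard hsub
  rw [Set.ncard_insert_of_notMem hxn, Set.ncard_insert_of_notMem hzn] at h1
  have h2 : (S.card - 1) * (mu - 1) ≤ (s - 1) * (mu - 1) :=
    Nat.mul_le_mul_right _ (by omega)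
  have h3 := h1.trans' (Nat.add_le_add_right (Nat.add_le_add_right
    (Nat.sub_le_of_le_add (hcard.trans (Nat.add_le_add_left h2 _))) 1) 1)
  have hs := H.one_le_s
  have h4 : lam + 2 ≤ ℓ.ncard + (s - 1) * (mu - 1) := by omega
  zify [hs, hmu] at h4
  linarith

theorem LargeCliqueHyp.exists_line (H : LargeCliqueHyp G k lam mu s) {x y : V}
    (hxy : G.Adj x y) : ∃ ℓ ∈ splsLines G lam mu s, x ∈ ℓ ∧ y ∈ ℓ := by
  classical
  by_contra! hcon
  let 𝒞 : Finset (Finset V) := {S | (∀ z ∈ S, G.Adj x z) ∧ ∀ z ∈ S, ∀ w ∈ S, ¬ G.Adj z w}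
  have hne : 𝒞.Nonempty := ⟨∅, by simp [𝒞]⟩
  obtain ⟨S, hS𝒞, hmax⟩ := Finset.exists_max_image 𝒞 Finset.card hne
  obtain ⟨hS, hind⟩ : (∀ z ∈ S, G.Adj x z) ∧ ∀ z ∈ S, ∀ w ∈ S, ¬ G.Adj z w := by
    simpa [𝒞] using hS𝒞
  have hmax' : ∀ T : Finset V, (∀ z ∈ T, G.Adj x z) → (∀ z ∈ T, ∀ w ∈ T, ¬ G.Adj z w) →
      T.card ≤ S.card := fun T h1 h2 => hmax T (by simpa [𝒞] using ⟨h1, h2⟩)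
  have hline : ∀ z : V, ∃ ℓ : Set V, z ∈ S → ℓ ∈ splsLines G lam mu s ∧ x ∈ ℓ ∧ z ∈ ℓ := by
    intro z
    by_cases hz : z ∈ S
    · obtain ⟨ℓ, h⟩ := H.exists_line_of_maximum hS hind hmax' hz
      exact ⟨ℓ, fun _ => h⟩
    · exact ⟨∅, fun h => absurd h hz⟩
  choose L hL using hline
  have hinj : Set.InjOn L S := by
    intro z hz w hw hzw
    by_contra hne
    exact hind z hz w hw ((hL z hz).1.1.1 (hL z hz).2.2 (hzw ▸ (hL w hw).2.2) hne)
  have hSs := H.card_coclique_le hS hind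
  obtain ⟨T, hT1, hT2, hT3⟩ := H.exists_coclique (x := x) (S.image L) {y}
    (by
      intro ℓ hℓ
      obtain ⟨z, hz, rfl⟩ := Finset.mem_image.1 hℓ
      exact ⟨(hL z hz).1, (hL z hz).2.1⟩)
    (by simpa using hxy) (by simp)
    (by
      intro z hz ℓ hℓ
      obtain ⟨w, hw, rfl⟩ := Finset.mem_image.1 hℓ
      rw [Finset.mem_singleton.1 hz]
      exact hcon _ (hL w hw).1 (hL w hw).2.1)
    (by rw [Finset.card_image_of_injOn hinj, Finset.card_singleton]; omega)
  have := hmax' T hT1 hT2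
  rw [hT3, Finset.card_image_of_injOn hinj, Finset.card_singleton] at this
  omega

theorem LargeCliqueHyp.existsUnique_line (H : LargeCliqueHyp G k lam mu s) :
    IsPointGraphOf G (splsLines G lam mu s) := by
  intro x y hxy
  obtain ⟨ℓ, hℓ, hx, hy⟩ := H.exists_line hxy
  exact ⟨ℓ, ⟨hℓ, hx, hy⟩, fun m hm => H.line_unique hm.1 hℓ hxy.ne hm.2.1 hx hm.2.2 hy⟩

theorem LargeCliqueHyp.ncard_lines_le (H : LargeCliqueHyp G k lam mu s) (x : V) :
    {ℓ ∈ splsLines G lam mu s | x ∈ ℓ}.ncard ≤ s := by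
  classical
  by_contra! hcard
  rw [Set.ncard_eq_toFinset_card'] at hcard
  obtain ⟨F, hF, hFcard⟩ := Finset.exists_subset_card_eq (Nat.succ_le_of_lt hcard)
  obtain ⟨T, hT1, hT2, hT3⟩ := H.exists_coclique (x := x) F ∅
    (fun ℓ hℓ => by simpa using hF hℓ) (by simp) (by simp) (by simp) (by simp [hFcard])
  have := H.card_coclique_le hT1 hT2
  rw [hT3, hFcard] at this
  simp at this

theorem LargeCliqueHyp.hasSPLS (H : LargeCliqueHyp G k lam mu s) (hs : 2 ≤ s) :
    HasSPLS G lam mu s :=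
  ⟨H.one_le_mu, hs, H.lam_bound, H.existsUnique_line, H.ncard_lines_le,
    fun _ hℓ _ hx => H.ncard_adj_le hℓ.1 hx⟩

end CliqueGeometry

section DistanceAlgebra

theorem exists_adj_dist_eq {G : SimpleGraph V} (hG : G.Connected) {x y : V} {i : ℕ}
    (hxy : G.dist x y = i + 1) : ∃ z, G.Adj y z ∧ G.dist x z = i := by
  obtain ⟨p, hp⟩ := hG.exists_walk_length_eq_dist y x
  rw [SimpleGraph.dist_comm, hxy] at hp
  cases p with
  | nil => simp at hp
  | @cons _ z _ hadj q =>
    refine ⟨z, hadj, ?_⟩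
    have h1 := SimpleGraph.dist_le q
    have h2 := hG.dist_triangle (u := x) (v := z) (w := y)
    rw [SimpleGraph.dist_eq_one_iff_adj.2 hadj.symm] at h2
    rw [SimpleGraph.dist_comm] at h1
    simp only [SimpleGraph.Walk.length_cons] at hp
    omega

/-- The matrix whose `(x, y)` entry is `f (d(x, y))`. -/
noncomputable def distMatrix (G : SimpleGraph V) (f : ℕ → ℝ) : Matrix V V ℝ :=
  Matrix.of fun x y => f (G.dist x y)

@[simp] theorem distMatrix_apply (G : SimpleGraph V) (f : ℕ → ℝ) (x y : V) :
    distMatrix G f x y = f (G.dist x y) := rfl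

theorem distMatrix_transpose (G : SimpleGraph V) (f : ℕ → ℝ) :
    (distMatrix G f).transpose = distMatrix G f := by
  ext x y
  simp [SimpleGraph.dist_comm]

theorem distMatrix_single_zero [DecidableEq V] {G : SimpleGraph V} (hG : G.Connected) :
    distMatrix G (Pi.single 0 1) = 1 := by
  ext x y
  simp [Matrix.one_apply, Pi.single_apply, hG.dist_eq_zero_iff]

theorem distMatrix_single_one {G : SimpleGraph V} [DecidableRel G.Adj] :
    distMatrix G (Pi.single 1 1) = G.adjMatrix ℝ := by
  ext x y
  simp [Pi.single_apply, SimpleGraph.dist_eq_one_iff_adj]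

variable [Fintype V] {G : SimpleGraph V} {D : ℕ} {cc aa bb : ℕ → ℕ}

theorem IsDRG.exists_dist_eq (h : IsDRG G D cc aa bb) {i : ℕ} (hi : i ≤ D) :
    ∃ x y, G.dist x y = i := by
  obtain ⟨hconn, -, ⟨x, y, hxy⟩, -⟩ := h
  induction hi using Nat.decreasingInduction with
  | self => exact ⟨x, y, hxy⟩
  | of_succ j _ ih =>
    obtain ⟨x', y', hxy'⟩ := ih
    obtain ⟨z, -, hz⟩ := exists_adj_dist_eq hconn hxy'
    exact ⟨x', z, hz⟩

theorem IsDRG.cc_zero (h : IsDRG G D cc aa bb) : cc 0 = 0 := by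
  obtain ⟨x, y, hxy⟩ := h.exists_dist_eq (Nat.zero_le D)
  rw [← (h.2.2.2 0 (Nat.zero_le D) x y hxy).1, Set.ncard_eq_zero, Set.eq_empty_iff_forall_notMem]
  rintro z ⟨hz, hxz⟩
  rw [h.1.dist_eq_zero_iff] at hxy
  rw [← hxy, ← SimpleGraph.dist_eq_one_iff_adj, hxz] at hz
  exact absurd hz (by norm_num)

theorem IsDRG.aa_zero (h : IsDRG G D cc aa bb) : aa 0 = 0 := by
  obtain ⟨x, y, hxy⟩ := h.exists_dist_eq (Nat.zero_le D)
  have h1 := h.2.2.2 0 (Nat.zero_le D) x y hxy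
  exact h1.2.1.symm.trans (h1.1.trans h.cc_zero)

theorem IsDRG.bb_diam (h : IsDRG G D cc aa bb) : bb D = 0 := by
  obtain ⟨x, y, hxy⟩ := h.exists_dist_eq le_rfl
  rw [← (h.2.2.2 D le_rfl x y hxy).2.2, Set.ncard_eq_zero, Set.eq_empty_iff_forall_notMem]
  rintro z ⟨-, hz⟩
  have := h.2.1 x z
  omega

theorem IsDRG.cc_pos (h : IsDRG G D cc aa bb) {i : ℕ} (hi : i + 1 ≤ D) : 0 < cc (i + 1) := by
  obtain ⟨x, y, hxy⟩ := h.exists_dist_eq hi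
  rw [← (h.2.2.2 _ hi x y hxy).1, Set.ncard_pos]
  obtain ⟨z, hz⟩ := exists_adj_dist_eq h.1 hxy
  exact ⟨z, by simpa using hz⟩

/-- The action of the intersection numbers on functions of the distance. -/
def intersectionOp (cc aa bb : ℕ → ℕ) (f : ℕ → ℝ) (i : ℕ) : ℝ :=
  cc i * f (i - 1) + aa i * f i + bb i * f (i + 1)

theorem IsDRG.sum_adj (h : IsDRG G D cc aa bb) [DecidableRel G.Adj] (f : ℕ → ℝ) (x y : V) :
    ∑ z, (if G.Adj y z then f (G.dist x z) else 0) =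
      intersectionOp cc aa bb f (G.dist x y) := by
  classical
  obtain ⟨i, hi⟩ : ∃ i, G.dist x y = i := ⟨_, rfl⟩
  obtain ⟨h1, h2, h3⟩ := h.2.2.2 i (hi ▸ h.2.1 x y) x y hi
  rcases Nat.eq_zero_or_pos i with rfl | hpos
  · obtain rfl := h.1.dist_eq_zero_iff.1 hi
    rw [hi, intersectionOp, h.cc_zero, h.aa_zero, ← h3, Set.ncard_eq_toFinset_card']
    simp only [Nat.cast_zero, zero_mul, zero_add]
    rw [← nsmul_eq_mul, ← Finset.sum_const, ← Finset.sum_filter]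
    refine Finset.sum_congr ?_ ?_
    · ext z
      simp [SimpleGraph.dist_eq_one_iff_adj]
    · intro z hz
      simp only [Set.toFinset_ofPred, Finset.mem_filter] at hz
      rw [hz.2.2]
  · rw [hi, intersectionOp, ← h1, ← h2, ← h3]
    simp only [Set.ncard_eq_toFinset_card', ← nsmul_eq_mul, ← Finset.sum_const]
    simp only [Set.toFinset_ofPred, Finset.sum_filter, ← Finset.sum_add_distrib]
    refine Finset.sum_congr rfl fun z _ => ?_
    by_cases hz : G.Adj y z
    · have hd := hz.diff_dist_adj (u := x)
      rw [hi] at hd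
      rcases hd with hd | hd | hd
      · simp [hz, hd, show i ≠ i - 1 by omega]
      · simp [hz, hd, show i + 1 ≠ i - 1 by omega]
      · simp [hz, hd, show i - 1 ≠ i by omega, show i - 1 ≠ i + 1 by omega]
    · simp [hz]

variable [DecidableRel G.Adj]

theorem IsDRG.adjMatrix_mul_distMatrix (h : IsDRG G D cc aa bb) (f : ℕ → ℝ) :
    G.adjMatrix ℝ * distMatrix G f = distMatrix G (intersectionOp cc aa bb f) := by
  ext x y
  rw [distMatrix_apply, SimpleGraph.dist_comm, ← h.sum_adj, Matrix.mul_apply]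
  refine Finset.sum_congr rfl fun z _ => ?_
  rw [SimpleGraph.adjMatrix_apply, distMatrix_apply, SimpleGraph.dist_comm, ite_mul, one_mul,
    zero_mul]

theorem IsDRG.distMatrix_mul_adjMatrix (h : IsDRG G D cc aa bb) (f : ℕ → ℝ) :
    distMatrix G f * G.adjMatrix ℝ = distMatrix G (intersectionOp cc aa bb f) := by
  rw [← distMatrix_transpose G (intersectionOp cc aa bb f), ← h.adjMatrix_mul_distMatrix,
    Matrix.transpose_mul, distMatrix_transpose, SimpleGraph.transpose_adjMatrix]

variable [DecidableEq V]

theorem intersectionOp_single_succ (i : ℕ) :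
    intersectionOp cc aa bb (Pi.single (i + 1) 1) =
      (cc (i + 2) : ℝ) • Pi.single (i + 2) 1 + (aa (i + 1) : ℝ) • Pi.single (i + 1) 1 +
        (bb i : ℝ) • (Pi.single i 1 : ℕ → ℝ) := by
  funext j
  simp only [intersectionOp, Pi.single_apply, Pi.add_apply, Pi.smul_apply, smul_eq_mul]
  rcases lt_trichotomy j (i + 1) with hj | rfl | hj
  · rcases Nat.lt_or_ge j i with hj' | hj'
    · simp [show j - 1 ≠ i + 1 by omega, show j ≠ i + 1 by omega, show j ≠ i by omega,
        show j ≠ i + 2 by omega]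
    · obtain rfl : j = i := by omega
      simp [show j - 1 ≠ j + 1 by omega]
  · simp
  · rcases Nat.lt_or_ge (i + 2) j with hj' | hj'
    · simp [show j - 1 ≠ i + 1 by omega, show j ≠ i + 1 by omega, show j ≠ i by omega,
        show j ≠ i + 2 by omega]
    · obtain rfl : j = i + 2 := by omega
      simp

theorem IsDRG.distMatrix_single_mem_adjoin (h : IsDRG G D cc aa bb) (i : ℕ) (hi : i + 1 ≤ D) :
    distMatrix G (Pi.single i 1) ∈ Algebra.adjoin ℝ {G.adjMatrix ℝ} ∧
      distMatrix G (Pi.single (i + 1) 1) ∈ Algebra.adjoin ℝ {G.adjMatrix ℝ} := by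
  induction i with
  | zero =>
    rw [distMatrix_single_zero h.1, zero_add, distMatrix_single_one]
    exact ⟨one_mem _, Algebra.self_mem_adjoin_singleton ℝ _⟩
  | succ i ih =>
    obtain ⟨h1, h2⟩ := ih (by omega)
    refine ⟨h2, ?_⟩
    have hc : (cc (i + 2) : ℝ) ≠ 0 := by exact_mod_cast (h.cc_pos (i := i + 1) hi).ne'
    have h3 := h.adjMatrix_mul_distMatrix (Pi.single (i + 1) 1)
    rw [intersectionOp_single_succ] at h3
    have h4 : distMatrix G (Pi.single (i + 2) 1) =
        (cc (i + 2) : ℝ)⁻¹ • (G.adjMatrix ℝ * distMatrix G (Pi.single (i + 1) 1) -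
          (aa (i + 1) : ℝ) • distMatrix G (Pi.single (i + 1) 1) -
          (bb i : ℝ) • distMatrix G (Pi.single i 1)) := by
      rw [h3]
      ext x y
      simp only [Matrix.smul_apply, Matrix.sub_apply, distMatrix_apply, Pi.add_apply,
        Pi.smul_apply, smul_eq_mul]
      field_simp
      ring
    rw [h4]
    exact Subalgebra.smul_mem _ (sub_mem (sub_mem (mul_mem
      (Algebra.self_mem_adjoin_singleton ℝ _) h2) (Subalgebra.smul_mem _ h2 _))
      (Subalgebra.smul_mem _ h1 _)) _

theorem IsDRG.distMatrix_mem_adjoin (h : IsDRG G D cc aa bb) (hD : 1 ≤ D) (f : ℕ → ℝ) :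
    distMatrix G f ∈ Algebra.adjoin ℝ {G.adjMatrix ℝ} := by
  have hsum : distMatrix G f =
      ∑ i ∈ Finset.range (D + 1), f i • distMatrix G (Pi.single i 1) := by
    ext x y
    have := h.2.1 x y
    simp [Matrix.sum_apply, Pi.single_apply, show G.dist x y < D + 1 by omega]
  rw [hsum]
  refine sum_mem fun i hi => Subalgebra.smul_mem _ ?_ _
  rw [Finset.mem_range] at hi
  cases i with
  | zero => exact (h.distMatrix_single_mem_adjoin 0 hD).1
  | succ i => exact (h.distMatrix_single_mem_adjoin i (by omega)).2

theorem IsDRG.exists_distMatrix_mul_self (h : IsDRG G D cc aa bb) (hD : 1 ≤ D) {f : ℕ → ℝ}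
    {θ : ℝ} (hf0 : f 0 = 1) (hf : ∀ i ≤ D, intersectionOp cc aa bb f i = θ * f i) :
    ∃ c : ℝ, 0 < c ∧ distMatrix G f * distMatrix G f = c • distMatrix G f := by
  have hA : G.adjMatrix ℝ * distMatrix G f = θ • distMatrix G f := by
    rw [h.adjMatrix_mul_distMatrix]
    ext x y
    simp [hf _ (h.2.1 x y)]
  have hM : ∀ M ∈ Algebra.adjoin ℝ {G.adjMatrix ℝ},
      ∃ c : ℝ, M * distMatrix G f = c • distMatrix G f := by
    intro M hM
    induction hM using Algebra.adjoin_induction with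
    | mem M hM => exact ⟨θ, by rw [Set.mem_singleton_iff.1 hM, hA]⟩
    | algebraMap r => exact ⟨r, by rw [Algebra.algebraMap_eq_smul_one, smul_mul_assoc, one_mul]⟩
    | add M N _ _ hM hN =>
      obtain ⟨c, hc⟩ := hM
      obtain ⟨d, hd⟩ := hN
      exact ⟨c + d, by rw [add_mul, hc, hd, add_smul]⟩
    | mul M N _ _ hM hN =>
      obtain ⟨c, hc⟩ := hM
      obtain ⟨d, hd⟩ := hN
      exact ⟨d * c, by rw [mul_assoc, hd, mul_smul_comm, hc, smul_smul]⟩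
  obtain ⟨c, hc⟩ := hM _ (h.distMatrix_mem_adjoin hD f)
  refine ⟨c, ?_, hc⟩
  obtain ⟨x, -, -⟩ := h.exists_dist_eq (Nat.zero_le D)
  have hx := congrFun (congrFun hc x) x
  rw [Matrix.mul_apply, Matrix.smul_apply, distMatrix_apply, SimpleGraph.dist_self, hf0,
    smul_eq_mul, mul_one] at hx
  rw [← hx]
  refine Finset.sum_pos' (fun z _ => ?_) ⟨x, Finset.mem_univ _, ?_⟩
  · rw [distMatrix_apply, distMatrix_apply, SimpleGraph.dist_comm]
    exact mul_self_nonneg _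
  · simp [hf0]

/-- The Rayleigh quotient of `distMatrix G f` for an eigenfunction `f` of the intersection
numbers. -/
theorem IsDRG.exists_sum_sq_eq (h : IsDRG G D cc aa bb) (hD : 1 ≤ D) {f : ℕ → ℝ}
    {θ : ℝ} (hf0 : f 0 = 1) (hf : ∀ i ≤ D, intersectionOp cc aa bb f i = θ * f i) :
    ∃ c : ℝ, 0 < c ∧ ∀ C : Finset V,
      ∑ y, (∑ z ∈ C, f (G.dist y z)) ^ 2 = c * ∑ y ∈ C, ∑ z ∈ C, f (G.dist y z) := by
  obtain ⟨c, hc, hmul⟩ := h.exists_distMatrix_mul_self hD hf0 hf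
  refine ⟨c, hc, fun C => ?_⟩
  have hent : ∀ x z, ∑ y, f (G.dist y x) * f (G.dist y z) = c * f (G.dist x z) := by
    intro x z
    have := congrFun (congrFun hmul x) z
    rw [Matrix.mul_apply, Matrix.smul_apply, distMatrix_apply, smul_eq_mul] at this
    rw [← this]
    exact Finset.sum_congr rfl fun y _ => by
      rw [distMatrix_apply, distMatrix_apply, SimpleGraph.dist_comm (u := x)]
  simp only [sq, Finset.sum_mul_sum]
  rw [Finset.sum_comm, Finset.mul_sum]
  refine Finset.sum_congr rfl fun x _ => ?_
  rw [Finset.sum_comm, Finset.mul_sum]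
  exact Finset.sum_congr rfl fun z _ => hent x z

/-- A positive solution `w` of the sign-alternated recurrence bounds all eigenvalues below. -/
theorem IsDRG.neg_le_eigenvalue (h : IsDRG G D cc aa bb) {w : ℕ → ℝ} {r : ℝ}
    (hw : 0 < w 0)
    (hrec : ∀ i ≤ D, cc i * w (i - 1) + bb i * w (i + 1) = (aa i + r) * w i)
    (hwn : ∀ i ≤ D + 1, 0 ≤ w i)
    {θ : ℝ} {v : V → ℝ} (hv : v ≠ 0) (hθ : (G.adjMatrix ℝ).mulVec v = θ • v) : -r ≤ θ := by
  obtain ⟨x, hx⟩ := Function.ne_iff.1 hv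
  let g : ℕ → ℝ := fun i => ∑ y with G.dist x y = i, v y
  have hρ : ∀ f : ℕ → ℝ, (distMatrix G f).mulVec v x = ∑ i ∈ Finset.range (D + 1), f i * g i := by
    intro f
    have hmaps : ∀ y ∈ (Finset.univ : Finset V), G.dist x y ∈ Finset.range (D + 1) := fun y _ =>
      Finset.mem_range.2 (Nat.lt_succ_of_le (h.2.1 x y))
    rw [Matrix.mulVec, dotProduct, ← Finset.sum_fiberwise_of_maps_to hmaps]
    refine Finset.sum_congr rfl fun i _ => ?_
    rw [Finset.mul_sum]
    refine Finset.sum_congr rfl fun y hy => ?_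
    rw [distMatrix_apply, (Finset.mem_filter.1 hy).2]
  have hρT : ∀ f : ℕ → ℝ, (distMatrix G (intersectionOp cc aa bb f)).mulVec v x =
      θ * (distMatrix G f).mulVec v x := by
    intro f
    rw [← h.distMatrix_mul_adjMatrix, ← Matrix.mulVec_mulVec, hθ, Matrix.mulVec_smul,
      Pi.smul_apply, smul_eq_mul]
  let f : ℕ → ℝ := fun i => w i * SignType.sign (g i)
  have hfg : ∀ i, f i * g i = w i * |g i| := by
    intro i
    simp only [f]
    rw [mul_assoc, sign_mul_self]
  have hfle : ∀ i ≤ D + 1, ∀ j, -(w i * |g j|) ≤ f i * g j := by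
    intro i hi j
    refine (abs_le.1 ?_).1
    rw [abs_mul, abs_mul, abs_of_nonneg (hwn i hi)]
    refine mul_le_mul_of_nonneg_right ?_ (abs_nonneg _)
    refine mul_le_of_le_one_right (hwn i hi) ?_
    rcases SignType.sign (g i) with _ | _ | _ <;> simp
  have hterm : ∀ i ∈ Finset.range (D + 1),
      -r * (w i * |g i|) ≤ intersectionOp cc aa bb f i * g i := by
    intro i hi
    have hi' : i ≤ D := Nat.lt_succ_iff.1 (Finset.mem_range.1 hi)
    have h1 := mul_le_mul_of_nonneg_left (hfle (i - 1) (by omega) i) (Nat.cast_nonneg (α := ℝ) (cc i))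
    have h2 := mul_le_mul_of_nonneg_left (hfle (i + 1) (by omega) i) (Nat.cast_nonneg (α := ℝ) (bb i))
    have h3 := congrArg (· * |g i|) (hrec i hi')
    have h4 := hfg i
    simp only [intersectionOp] at h3 ⊢
    linear_combination h1 + h2 + h3 - (aa i : ℝ) * h4
  have hsum := Finset.sum_le_sum hterm
  rw [← Finset.mul_sum, ← hρ, hρT, hρ, Finset.sum_congr rfl fun i _ => hfg i] at hsum
  refine le_of_mul_le_mul_right hsum ?_
  refine Finset.sum_pos' (fun i hi => mul_nonneg (hwn i (Finset.mem_range.1 hi).le)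
    (abs_nonneg _)) ⟨0, by simp, ?_⟩
  refine mul_pos hw (abs_pos.2 ?_)
  have hg0 : g 0 = v x := by
    have : (Finset.univ.filter fun y => G.dist x y = 0) = {x} := by
      ext y
      simp [h.1.dist_eq_zero_iff, eq_comm]
    simp only [g]
    rw [this, Finset.sum_singleton]
  rw [hg0]
  simpa using hx

theorem IsDRG.quadratic_form_ge (h : IsDRG G D cc aa bb) {w : ℕ → ℝ} {r : ℝ}
    (hw : 0 < w 0)
    (hrec : ∀ i ≤ D, cc i * w (i - 1) + bb i * w (i + 1) = (aa i + r) * w i)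
    (hwn : ∀ i ≤ D + 1, 0 ≤ w i) (v : V → ℝ) :
    -r * ∑ x, v x ^ 2 ≤ ∑ x, ∑ y, if G.Adj x y then v x * v y else 0 := by
  have hA : (G.adjMatrix ℝ).IsHermitian := by
    rw [Matrix.IsHermitian, Matrix.conjTranspose_eq_transpose_of_trivial,
      SimpleGraph.transpose_adjMatrix]
  have hH : (G.adjMatrix ℝ + r • (1 : Matrix V V ℝ)).IsHermitian := by
    refine hA.add ?_
    rw [Matrix.IsHermitian, Matrix.conjTranspose_eq_transpose_of_trivial, Matrix.transpose_smul,
      Matrix.transpose_one]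
  have hpsd : (G.adjMatrix ℝ + r • (1 : Matrix V V ℝ)).PosSemidef := by
    rw [hH.posSemidef_iff_eigenvalues_nonneg]
    intro i
    have h1 := hH.mulVec_eigenvectorBasis i
    have h2 : (hH.eigenvectorBasis i : V → ℝ) ≠ 0 := by
      intro h0
      exact hH.eigenvectorBasis.orthonormal.ne_zero i (by ext j; exact congrFun h0 j)
    have h3 := h.neg_le_eigenvalue hw hrec hwn (θ := hH.eigenvalues i - r) h2 (by
      rw [Matrix.add_mulVec, Matrix.smul_mulVec, Matrix.one_mulVec] at h1
      rw [sub_smul, ← h1, add_sub_cancel_right])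
    simp only [Pi.zero_apply]
    linarith
  have h1 := hpsd.dotProduct_mulVec_nonneg v
  rw [Matrix.add_mulVec, Matrix.smul_mulVec, Matrix.one_mulVec, dotProduct_add, dotProduct_smul,
    star_trivial] at h1
  have h2 : v ⬝ᵥ (G.adjMatrix ℝ).mulVec v = ∑ x, ∑ y, if G.Adj x y then v x * v y else 0 := by
    simp only [dotProduct, Matrix.mulVec, Finset.mul_sum, SimpleGraph.adjMatrix_apply]
    exact Finset.sum_congr rfl fun x _ => Finset.sum_congr rfl fun y _ => by
      split_ifs <;> simp
  have h3 : v ⬝ᵥ v = ∑ x, v x ^ 2 := by simp [dotProduct, sq]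
  rw [h2, h3, smul_eq_mul] at h1
  linarith

end DistanceAlgebra

section ClassicalParameters

theorem gauss_succ (b j : ℕ) : gauss b (j + 1) = gauss b j + (b : ℝ) ^ j :=
  Finset.sum_range_succ _ _

@[simp] theorem gauss_zero (b : ℕ) : gauss b 0 = 0 := by simp [gauss]

@[simp] theorem gauss_one (b : ℕ) : gauss b 1 = 1 := by simp [gauss]

theorem gauss_two (b : ℕ) : gauss b 2 = 1 + b := by simp [gauss, Finset.sum_range_succ]

theorem gauss_three (b : ℕ) : gauss b 3 = 1 + b + (b : ℝ) ^ 2 := by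
  simp [gauss, Finset.sum_range_succ]

theorem gauss_mono (b : ℕ) : Monotone (gauss b) :=
  monotone_nat_of_le_succ fun j => by
    rw [gauss_succ]
    exact le_add_of_nonneg_right (by positivity)

theorem gauss_nonneg (b j : ℕ) : 0 ≤ gauss b j :=
  Finset.sum_nonneg fun _ _ => by positivity

/-- The moduli of the cosine sequence belonging to the eigenvalue `-[D]`. -/
noncomputable def cosineAbs (b : ℕ) (α β : ℝ) (i : ℕ) : ℝ :=
  ∏ j ∈ Finset.range i, (1 + α * gauss b j) / (β - α * gauss b j)

variable [Fintype V] {G : SimpleGraph V} {D b : ℕ} {α β : ℝ} {cc aa bb : ℕ → ℕ}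

theorem HasClassicalParams.cc_eq (h : HasClassicalParams G D b α β cc aa bb) {i : ℕ}
    (hi : i ≤ D) : (cc i : ℝ) = gauss b i * (1 + α * gauss b (i - 1)) := by
  rcases Nat.eq_zero_or_pos i with rfl | hpos
  · simp [h.1.cc_zero]
  · exact h.2.2 i hpos hi

theorem HasClassicalParams.bb_eq (h : HasClassicalParams G D b α β cc aa bb) {i : ℕ}
    (hi : i ≤ D) : (bb i : ℝ) = (gauss b D - gauss b i) * (β - α * gauss b i) := by
  rcases hi.lt_or_eq with hlt | rfl
  · exact h.2.1 i (by omega)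
  · simp [h.1.bb_diam]

theorem HasClassicalParams.aa_eq (h : HasClassicalParams G D b α β cc aa bb) {i : ℕ}
    (hi : i ≤ D) : (aa i : ℝ) = gauss b D * β - bb i - cc i := by
  classical
  obtain ⟨x, y, hxy⟩ := h.1.exists_dist_eq hi
  have h1 := h.1.sum_adj (fun _ => 1) x y
  have h2 := h.1.sum_adj (fun _ => 1) y y
  rw [h1, SimpleGraph.dist_self, hxy] at h2
  simp only [intersectionOp, h.1.cc_zero, h.1.aa_zero, h.bb_eq (Nat.zero_le D), gauss_zero,
    mul_one, mul_zero, sub_zero, Nat.cast_zero, zero_add] at h2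
  linarith

theorem HasClassicalParams.alpha_nonneg (h : HasClassicalParams G D b α β cc aa bb)
    (hD : 3 ≤ D) : 0 ≤ α := by
  have h2 := h.cc_eq (i := 2) (by omega)
  have h3 := h.cc_eq (i := 3) hD
  have hpos : (0 : ℝ) < cc 3 := by exact_mod_cast h.1.cc_pos (i := 2) hD
  rw [gauss_two] at h2
  simp only [Nat.add_one_sub_one, gauss_one, gauss_two, gauss_three, mul_one]
    at h2 h3
  rw [h3] at hpos
  have h4 : 0 < 1 + α * (1 + (b : ℝ)) := pos_of_mul_pos_right hpos (by positivity)
  have h5 : (b : ℝ) < cc 2 := by linarith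
  have h6 : b + 1 ≤ cc 2 := by exact_mod_cast h5
  have h7 : (b : ℝ) + 1 ≤ cc 2 := by exact_mod_cast h6
  have h8 : 0 ≤ (1 + (b : ℝ)) * α := by linarith
  exact nonneg_of_mul_nonneg_right h8 (by positivity)

theorem alpha_mul_gauss_lt (hb : 2 ≤ b) (hD : 3 ≤ D) (hα : 0 ≤ α)
    (hβ : (1 / 3 : ℝ) * (8 * α * (b : ℝ) + 8 * (b : ℝ) + 5 * α) * gauss b D ≤ β) {i : ℕ}
    (hi : i ≤ D) : α * gauss b i < β := by
  have hb' : (2 : ℝ) ≤ b := by exact_mod_cast hb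
  have hr : 1 ≤ gauss b D := by
    rw [← gauss_one b]
    exact gauss_mono b (by omega)
  have h1 : α * gauss b i ≤ α * gauss b D := mul_le_mul_of_nonneg_left (gauss_mono b hi) hα
  have h2 : 0 ≤ α * b := by positivity
  have h3 : (α + 1) * gauss b D ≤
      (1 / 3 : ℝ) * (8 * α * (b : ℝ) + 8 * (b : ℝ) + 5 * α) * gauss b D := by
    refine mul_le_mul_of_nonneg_right ?_ (gauss_nonneg _ _)
    nlinarith
  linarith

theorem cosineAbs_nonneg (hα : 0 ≤ α) (hlt : ∀ i ≤ D, α * gauss b i < β) {i : ℕ}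
    (hi : i ≤ D + 1) : 0 ≤ cosineAbs b α β i := by
  refine Finset.prod_nonneg fun j hj => div_nonneg ?_ ?_
  · have := gauss_nonneg b j
    positivity
  · have := hlt j (by have := Finset.mem_range.1 hj; omega)
    linarith

theorem HasClassicalParams.cosineAbs_rec (h : HasClassicalParams G D b α β cc aa bb)
    (hlt : ∀ i ≤ D, α * gauss b i < β) {i : ℕ} (hi : i ≤ D) :
    cc i * cosineAbs b α β (i - 1) + bb i * cosineAbs b α β (i + 1) =
      (aa i + gauss b D) * cosineAbs b α β i := by
  have hne : β - α * gauss b i ≠ 0 := by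
    have := hlt i hi
    linarith
  have h1 : cosineAbs b α β (i + 1) =
      cosineAbs b α β i * ((1 + α * gauss b i) / (β - α * gauss b i)) :=
    Finset.prod_range_succ _ _
  have hbb : (bb i : ℝ) * cosineAbs b α β (i + 1) =
      (gauss b D - gauss b i) * (1 + α * gauss b i) * cosineAbs b α β i := by
    rw [h1, h.bb_eq hi]
    generalize β - α * gauss b i = d at hne
    field_simp
  have hcc : (cc i : ℝ) * cosineAbs b α β (i - 1) =
      gauss b i * (β - α * gauss b (i - 1)) * cosineAbs b α β i := by
    cases i with
    | zero => simp [h.1.cc_zero]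
    | succ j =>
      have hne' : β - α * gauss b j ≠ 0 := by
        have := hlt j (by omega)
        linarith
      have h2 : cosineAbs b α β (j + 1) =
          cosineAbs b α β j * ((1 + α * gauss b j) / (β - α * gauss b j)) :=
        Finset.prod_range_succ _ _
      rw [h.cc_eq hi, h2, Nat.add_sub_cancel]
      field_simp
  rw [hbb, hcc, h.aa_eq hi, h.bb_eq hi, h.cc_eq hi]
  ring

theorem HasClassicalParams.cosine_rec (h : HasClassicalParams G D b α β cc aa bb)
    (hlt : ∀ i ≤ D, α * gauss b i < β) (i : ℕ) (hi : i ≤ D) :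
    intersectionOp cc aa bb (fun j => (-1) ^ j * cosineAbs b α β j) i =
      -gauss b D * ((-1) ^ i * cosineAbs b α β i) := by
  have h1 := h.cosineAbs_rec hlt hi
  cases i with
  | zero =>
    simp only [intersectionOp, h.1.cc_zero, Nat.cast_zero, zero_mul, zero_add, pow_zero,
      pow_one] at h1 ⊢
    linear_combination -h1
  | succ j =>
    simp only [intersectionOp, Nat.add_sub_cancel] at h1 ⊢
    linear_combination (-1) ^ j * h1

/-- For a clique `C`, the sums of the cosines of `-[D]` over `C`. -/
theorem HasClassicalParams.exists_clique_identity (h : HasClassicalParams G D b α β cc aa bb)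
    (hD : 1 ≤ D) (hlt : ∀ i ≤ D, α * gauss b i < β) :
    ∃ c : ℝ, 0 < c ∧ ∀ C : Finset V, G.IsClique (C : Set V) →
      ∑ y, (∑ z ∈ C, (-1) ^ G.dist y z * cosineAbs b α β (G.dist y z)) ^ 2 =
        c * (C.card * (1 - (C.card - 1) / β)) := by
  classical
  obtain ⟨c, hc, hC⟩ := h.1.exists_sum_sq_eq hD (f := fun j => (-1) ^ j * cosineAbs b α β j)
    (by simp [cosineAbs]) (h.cosine_rec hlt)
  refine ⟨c, hc, fun C hcl => ?_⟩
  rw [hC C]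
  congr 1
  rw [← nsmul_eq_mul, ← Finset.sum_const]
  refine Finset.sum_congr rfl fun y hy => ?_
  rw [← Finset.add_sum_erase C _ hy]
  have h1 : ∑ z ∈ C.erase y, (-1 : ℝ) ^ G.dist y z * cosineAbs b α β (G.dist y z) =
      ∑ z ∈ C.erase y, (-1 / β) := by
    refine Finset.sum_congr rfl fun z hz => ?_
    obtain ⟨hzy, hzC⟩ := Finset.mem_erase.1 hz
    rw [SimpleGraph.dist_eq_one_iff_adj.2 (hcl hy hzC hzy.symm)]
    simp [cosineAbs]
    ring
  rw [h1, Finset.sum_const, Finset.card_erase_of_mem hy, SimpleGraph.dist_self, nsmul_eq_mul,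
    Nat.cast_sub (Finset.card_pos.2 ⟨y, hy⟩)]
  simp [cosineAbs]
  ring

/-- The Delsarte bound for cliques. -/
theorem HasClassicalParams.ncard_clique_le (h : HasClassicalParams G D b α β cc aa bb)
    (hD : 1 ≤ D) (hlt : ∀ i ≤ D, α * gauss b i < β) {C : Set V}
    (hC : G.IsClique C) : (C.ncard : ℝ) ≤ β + 1 := by
  classical
  have hβ : 0 < β := by simpa using hlt 0 (Nat.zero_le D)
  obtain ⟨c, hc, hid⟩ := h.exists_clique_identity hD hlt
  have h1 := hid C.toFinset (by simpa using hC)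
  rw [← Set.ncard_eq_toFinset_card'] at h1
  have h2 : 0 ≤ c * (C.ncard * (1 - ((C.ncard : ℝ) - 1) / β)) :=
    h1 ▸ Finset.sum_nonneg fun _ _ => sq_nonneg _
  rcases Nat.eq_zero_or_pos C.ncard with h0 | hpos
  · rw [h0, Nat.cast_zero]
    linarith
  · have h3 := nonneg_of_mul_nonneg_right (nonneg_of_mul_nonneg_right h2 hc)
      (by exact_mod_cast hpos)
    have h4 : ((C.ncard : ℝ) - 1) / β ≤ 1 := by linarith
    rw [div_le_one hβ] at h4
    linarith

/-- A vertex at distance one from a Delsarte clique has `α + 1` neighbours in it. -/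
theorem HasClassicalParams.ncard_adj_of_delsarte (h : HasClassicalParams G D b α β cc aa bb)
    (hD : 1 ≤ D) (hlt : ∀ i ≤ D, α * gauss b i < β) {C : Set V}
    (hC : G.IsClique C) (hcard : (C.ncard : ℝ) = β + 1) {y z : V} (hy : y ∉ C) (hz : z ∈ C)
    (hyz : G.Adj y z) : ({w ∈ C | G.Adj y w}.ncard : ℝ) = α + 1 := by
  classical
  have hβ : 0 < β := by simpa using hlt 0 (Nat.zero_le D)
  have hβα : 0 < β - α := by
    have := hlt 1 hD
    rw [gauss_one] at this
    linarith
  obtain ⟨c, hc, hid⟩ := h.exists_clique_identity hD hlt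
  have h1 := hid C.toFinset (by simpa using hC)
  rw [← Set.ncard_eq_toFinset_card', hcard, add_sub_cancel_right, div_self hβ.ne', sub_self,
    mul_zero, mul_zero, Finset.sum_eq_zero_iff_of_nonneg fun _ _ => sq_nonneg _] at h1
  have h2 := pow_eq_zero_iff two_ne_zero |>.1 (h1 y (Finset.mem_univ _))
  have hdist : ∀ w ∈ C.toFinset, (-1 : ℝ) ^ G.dist y w * cosineAbs b α β (G.dist y w) =
      (if G.Adj y w then -1 / β - (1 + α) / (β * (β - α)) else 0) +
        (1 + α) / (β * (β - α)) := by
    intro w hw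
    rw [Set.mem_toFinset] at hw
    by_cases hyw : G.Adj y w
    · rw [SimpleGraph.dist_eq_one_iff_adj.2 hyw, if_pos hyw]
      simp [cosineAbs]
      ring
    · have hne : y ≠ w := fun h => hy (h ▸ hw)
      have h3 := h.1.1.one_lt_dist_of_ne_of_not_adj hne hyw
      have h4 := h.1.1.dist_triangle (u := y) (v := z) (w := w)
      rw [SimpleGraph.dist_eq_one_iff_adj.2 hyz,
        SimpleGraph.dist_eq_one_iff_adj.2 (hC hz hw fun h => hyw (h ▸ hyz))] at h4
      rw [show G.dist y w = 2 by omega, if_neg hyw]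
      simp [cosineAbs, Finset.prod_range_succ]
  rw [Finset.sum_congr rfl hdist, Finset.sum_add_distrib, ← Finset.sum_filter, Finset.sum_const,
    Finset.sum_const, ← Set.ncard_eq_toFinset_card', nsmul_eq_mul, nsmul_eq_mul, hcard] at h2
  have h5 : {w ∈ C | G.Adj y w}.ncard = (C.toFinset.filter fun w => G.Adj y w).card := by
    rw [Set.ncard_eq_toFinset_card']
    congr 1
    ext w
    simp
  rw [← h5] at h2
  field_simp at h2
  have h6 : (β + 1) * (({w ∈ C | G.Adj y w}.ncard : ℝ) - (α + 1)) = 0 := by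
    linear_combination -h2
  have h7 := (mul_eq_zero.1 h6).resolve_left (by positivity)
  linarith

theorem HasClassicalParams.largeCliqueHyp (h : HasClassicalParams G D b α β cc aa bb)
    (hb : 2 ≤ b) (hD : 3 ≤ D)
    (hβ : (1 / 3 : ℝ) * (8 * α * (b : ℝ) + 8 * (b : ℝ) + 5 * α) * gauss b D ≤ β) :
    LargeCliqueHyp G (bb 0) (aa 1) (cc 2) (Nat.floor (4 * gauss b D / 3)) := by
  have hα := h.alpha_nonneg hD
  have hlt := fun i hi => alpha_mul_gauss_lt hb hD hα hβ (i := i) hi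
  have hβ0 : 0 < β := by simpa using hlt 0 (Nat.zero_le D)
  have hb' : (2 : ℝ) ≤ b := by exact_mod_cast hb
  have hr : 1 ≤ gauss b D := by
    rw [← gauss_one b]
    exact gauss_mono b (by omega)
  have hk := h.bb_eq (Nat.zero_le D)
  have hb1 := h.bb_eq (i := 1) (by omega)
  have hc1 := h.cc_eq (i := 1) (by omega)
  have ha := h.aa_eq (i := 1) (by omega)
  have hc := h.cc_eq (i := 2) (by omega)
  simp only [gauss_zero, mul_zero, sub_zero] at hk
  rw [gauss_one] at hb1
  simp only [gauss_one, tsub_self, gauss_zero, mul_zero, add_zero, mul_one] at hc1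
  rw [gauss_two] at hc
  simp only [Nat.add_one_sub_one, gauss_one, mul_one] at hc
  rw [hb1, hc1] at ha
  have hs1 := Nat.floor_le (show 0 ≤ 4 * gauss b D / 3 by positivity)
  have hs2 := Nat.lt_floor_add_one (4 * gauss b D / 3)
  set s := Nat.floor (4 * gauss b D / 3) with hs
  set r := gauss b D
  have hαb : 0 ≤ α * b := by positivity
  have hcnn : 0 ≤ α * b + α + b := by positivity
  refine ⟨?_, ?_, ?_, ?_, ?_, ?_, ?_⟩
  · intro x
    rw [← (h.1.2.2.2 0 (Nat.zero_le D) x x SimpleGraph.dist_self).2.2]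
    congr 1
    ext z
    simp [SimpleGraph.dist_eq_one_iff_adj]
  · intro x y hxy
    rw [← (h.1.2.2.2 1 (by omega) x y (SimpleGraph.dist_eq_one_iff_adj.2 hxy)).2.1]
    congr 1
    ext z
    simp [SimpleGraph.dist_eq_one_iff_adj, and_comm]
  · intro x y hne hxy
    have h2 := h.1.1.one_lt_dist_of_ne_of_not_adj hne hxy
    rcases (show 2 ≤ G.dist x y from h2).eq_or_lt with h3 | h3
    · rw [← (h.1.2.2.2 2 (by omega) x y h3.symm).1]
      refine le_of_eq ?_
      congr 1
      ext z
      simp [SimpleGraph.dist_eq_one_iff_adj, and_comm]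
    · have hempty : {z | G.Adj x z ∧ G.Adj y z} = ∅ := by
        rw [Set.eq_empty_iff_forall_notMem]
        rintro z ⟨hxz, hyz⟩
        have h4 := h.1.1.dist_triangle (u := x) (v := z) (w := y)
        rw [SimpleGraph.dist_eq_one_iff_adj.2 hxz,
          SimpleGraph.dist_eq_one_iff_adj.2 hyz.symm] at h4
        omega
      simp [hempty]
  · exact h.1.cc_pos (i := 1) (by omega)
  · exact (Nat.le_floor_iff (by positivity)).2 (by push_cast; linarith)
  · have h1 : (2 * (s : ℝ) - 1) * (α * b + α + b) ≤ (8 * r / 3 - 1) * (α * b + α + b) :=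
      mul_le_mul_of_nonneg_right (by linarith) hcnn
    have h2 : (2 * (s : ℝ) - 1) * ((cc 2 : ℝ) - 1) ≤ aa 1 := by
      rw [hc, ha]
      linarith
    exact_mod_cast h2
  · have h1 : (s : ℝ) * (α * b + α + b) ≤ (4 * r / 3) * (α * b + α + b) :=
      mul_le_mul_of_nonneg_right hs1 hcnn
    have h2 : α * 3 ≤ α * r := by
      refine mul_le_mul_of_nonneg_left ?_ hα
      have := gauss_mono b (show 2 ≤ D by omega)
      rw [gauss_two] at this
      linarith
    have h3 : 3 * β / 2 ≤ 2 * (β + α * (r - 1)) - s * (α * b + α + b) := by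
      linarith
    have h4 : (4 * r / 3) * (3 * β / 2) < ((s : ℝ) + 1) * (3 * β / 2) :=
      mul_lt_mul_of_pos_right hs2 (by positivity)
    have h5 : ((s : ℝ) + 1) * (3 * β / 2) ≤
        (s + 1) * (2 * (β + α * (r - 1)) - s * (α * b + α + b)) :=
      mul_le_mul_of_nonneg_left h3 (by positivity)
    have h6 : 2 * (bb 0 : ℝ) < 2 * (s + 1) * (aa 1 + 1) - s * (s + 1) * (cc 2 - 1) := by
      rw [hc, ha, hk]
      linarith
    exact_mod_cast h6

end ClassicalParameters

section PartialLinearSpace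

open scoped Classical in
/-- The number of lines of `𝓛` through `x`. -/
noncomputable def lineDegree (𝓛 : Finset (Set V)) (x : V) : ℕ :=
  {ℓ ∈ 𝓛 | x ∈ ℓ}.card

variable {G : SimpleGraph V} {𝓛 : Finset (Set V)}

open scoped Classical in
theorem IsPointGraphOf.card_eq_one (hG : IsPointGraphOf G 𝓛) {x y : V} (hxy : G.Adj x y) :
    {ℓ ∈ 𝓛 | x ∈ ℓ ∧ y ∈ ℓ}.card = 1 := by
  obtain ⟨ℓ, hℓ, huniq⟩ := hG x y hxy
  refine Finset.card_eq_one.2 ⟨ℓ, Finset.ext fun m => ?_⟩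
  rw [Finset.mem_filter, Finset.mem_singleton]
  constructor
  · exact fun hm => huniq m (by simpa using hm)
  · rintro rfl
    simpa using hℓ

open scoped Classical in
/-- A set of neighbours of `x` is partitioned by the lines through `x`. -/
theorem IsPointGraphOf.card_eq_sum (hG : IsPointGraphOf G 𝓛) {x : V} {T : Finset V}
    (hT : ∀ t ∈ T, G.Adj x t) : T.card = ∑ ℓ ∈ 𝓛 with x ∈ ℓ, {t ∈ T | t ∈ ℓ}.card := by
  have h1 := Finset.sum_card_bipartiteAbove_eq_sum_card_bipartiteBelow
    (s := T) (t := {ℓ ∈ 𝓛 | x ∈ ℓ}) (fun t ℓ => t ∈ ℓ)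
  simp only [Finset.bipartiteAbove, Finset.bipartiteBelow, Finset.filter_filter] at h1
  rw [← h1, Finset.sum_congr rfl fun t ht => hG.card_eq_one (hT t ht)]
  simp

variable [Fintype V]

open scoped Classical in
theorem exists_ne_zero_sum_line_eq_zero (hcard : 𝓛.card < Fintype.card V) :
    ∃ v : V → ℝ, v ≠ 0 ∧ ∀ ℓ ∈ 𝓛, ∑ x, (if x ∈ ℓ then v x else 0) = 0 := by
  let f : (V → ℝ) →ₗ[ℝ] (𝓛 → ℝ) := LinearMap.pi fun ℓ =>
    ∑ x, if x ∈ ℓ.1 then LinearMap.proj x else 0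
  have hker := LinearMap.ker_ne_bot_of_finrank_lt (f := f) (by simpa using hcard)
  obtain ⟨v, hv, hne⟩ := Submodule.exists_mem_ne_zero_of_ne_bot hker
  refine ⟨v, hne, fun ℓ hℓ => ?_⟩
  have h1 := congrFun (LinearMap.mem_ker.1 hv) ⟨ℓ, hℓ⟩
  simp only [f, LinearMap.pi_apply, LinearMap.sum_apply, Pi.zero_apply] at h1
  refine (Finset.sum_congr rfl fun x _ => ?_).trans h1
  split_ifs <;> simp

open scoped Classical in
theorem IsPointGraphOf.sum_sq_line_sum (hG : IsPointGraphOf G 𝓛) (hcl : ∀ ℓ ∈ 𝓛, G.IsClique ℓ)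
    (v : V → ℝ) :
    ∑ ℓ ∈ 𝓛, (∑ x, if x ∈ ℓ then v x else 0) ^ 2 =
      ∑ x, lineDegree 𝓛 x * v x ^ 2 + ∑ x, ∑ y, if G.Adj x y then v x * v y else 0 := by
  have h1 : ∀ ℓ ∈ 𝓛, (∑ x, if x ∈ ℓ then v x else 0) ^ 2 =
      ∑ x, ∑ y, if x ∈ ℓ ∧ y ∈ ℓ then v x * v y else 0 := by
    intro ℓ _
    rw [sq, Finset.sum_mul_sum]
    refine Finset.sum_congr rfl fun x _ => Finset.sum_congr rfl fun y _ => ?_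
    by_cases hx : x ∈ ℓ <;> by_cases hy : y ∈ ℓ <;> simp [hx, hy]
  rw [Finset.sum_congr rfl h1, Finset.sum_comm, ← Finset.sum_add_distrib]
  refine Finset.sum_congr rfl fun x _ => ?_
  have h2 : (lineDegree 𝓛 x : ℝ) * v x ^ 2 =
      ∑ y, if x = y then (lineDegree 𝓛 x : ℝ) * (v x * v y) else 0 := by
    simp [sq]
  rw [Finset.sum_comm, h2, ← Finset.sum_add_distrib]
  refine Finset.sum_congr rfl fun y _ => ?_
  rw [← Finset.sum_filter, Finset.sum_const, nsmul_eq_mul]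
  by_cases hxy : x = y
  · subst hxy
    simp [lineDegree]
  · by_cases hadj : G.Adj x y
    · rw [hG.card_eq_one hadj]
      simp [hxy, hadj]
    · have h0 : {ℓ ∈ 𝓛 | x ∈ ℓ ∧ y ∈ ℓ} = ∅ :=
        Finset.filter_eq_empty_iff.2 fun ℓ hℓ hm => hadj (hcl ℓ hℓ hm.1 hm.2 hxy)
      rw [h0]
      simp [hxy, hadj]

open scoped Classical in
/-- If every line is longer than the number of lines on each point, then there are fewer lines
than points. -/
theorem card_lines_lt_card [Nonempty V] {s : ℕ} (hdeg : ∀ x, lineDegree 𝓛 x ≤ s)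
    (hlong : ∀ ℓ ∈ 𝓛, s + 1 ≤ ℓ.ncard) : 𝓛.card < Fintype.card V := by
  have h1 := Finset.sum_card_bipartiteAbove_eq_sum_card_bipartiteBelow
    (s := (Finset.univ : Finset V)) (t := 𝓛) (fun t ℓ => t ∈ ℓ)
  have h2 : 𝓛.card * (s + 1) ≤
      ∑ ℓ ∈ 𝓛, (Finset.bipartiteBelow (fun (t : V) ℓ => t ∈ ℓ) Finset.univ ℓ).card := by
    rw [← smul_eq_mul]
    refine Finset.card_nsmul_le_sum _ _ _ fun ℓ hℓ => (hlong ℓ hℓ).trans_eq ?_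
    rw [Set.ncard_eq_toFinset_card']
    congr 1
    ext
    simp [Finset.bipartiteBelow]
  have h3 : ∑ x : V, (Finset.bipartiteAbove (fun (t : V) ℓ => t ∈ ℓ) 𝓛 x).card ≤
      Fintype.card V * s := by
    rw [← smul_eq_mul]
    exact Finset.sum_le_card_nsmul _ _ _ fun x _ => hdeg x
  have h4 : 0 < Fintype.card V := Fintype.card_pos
  by_contra! hle
  have h5 := Nat.mul_le_mul_right (s + 1) hle
  rw [mul_add, mul_one] at h5
  omega

end PartialLinearSpace

section DelsarteVertices

variable [Fintype V] {G : SimpleGraph V} {D b : ℕ} {α β : ℝ} {cc aa bb : ℕ → ℕ}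
  {𝓛 : Finset (Set V)}

open scoped Classical in
theorem HasClassicalParams.sum_ncard_sub_one (h : HasClassicalParams G D b α β cc aa bb)
    (hG : IsPointGraphOf G 𝓛) (hcl : ∀ ℓ ∈ 𝓛, G.IsClique ℓ) (x : V) :
    ∑ ℓ ∈ 𝓛 with x ∈ ℓ, ((ℓ.ncard : ℝ) - 1) = gauss b D * β := by
  have hk := h.bb_eq (Nat.zero_le D)
  simp only [gauss_zero, mul_zero, sub_zero] at hk
  rw [← hk, ← (h.1.2.2.2 0 (Nat.zero_le D) x x SimpleGraph.dist_self).2.2,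
    Set.ncard_eq_toFinset_card', hG.card_eq_sum (x := x) fun t ht => by simp_all]
  push_cast
  refine Finset.sum_congr rfl fun ℓ hℓ => ?_
  obtain ⟨hℓ, hx⟩ := Finset.mem_filter.1 hℓ
  have h1 : {t ∈ {z | G.Adj x z ∧ G.dist x z = 0 + 1}.toFinset | t ∈ ℓ} =
      ℓ.toFinset.erase x := by
    ext t
    simp only [Finset.mem_filter, Set.mem_toFinset, Finset.mem_erase, Set.mem_ofPred_eq]
    constructor
    · rintro ⟨⟨hadj, -⟩, ht⟩
      exact ⟨hadj.ne', ht⟩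
    · rintro ⟨hne, ht⟩
      have hadj := hcl ℓ hℓ hx ht hne.symm
      exact ⟨⟨hadj, by simpa using hadj⟩, ht⟩
  rw [h1, Finset.card_erase_of_mem (by simpa using hx), ← Set.ncard_eq_toFinset_card',
    Nat.cast_sub, Nat.cast_one]
  exact (Set.ncard_pos).2 ⟨x, hx⟩

theorem HasClassicalParams.gauss_le_lineDegree (h : HasClassicalParams G D b α β cc aa bb)
    (hD : 1 ≤ D) (hlt : ∀ i ≤ D, α * gauss b i < β) (hG : IsPointGraphOf G 𝓛)
    (hcl : ∀ ℓ ∈ 𝓛, G.IsClique ℓ) (x : V) : gauss b D ≤ lineDegree 𝓛 x := by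
  classical
  have hβ : 0 < β := by simpa using hlt 0 (Nat.zero_le D)
  have h1 : ∑ ℓ ∈ 𝓛 with x ∈ ℓ, ((ℓ.ncard : ℝ) - 1) ≤ ∑ ℓ ∈ 𝓛 with x ∈ ℓ, β :=
    Finset.sum_le_sum fun ℓ hℓ => by
      linarith [h.ncard_clique_le hD hlt (hcl ℓ (Finset.mem_filter.1 hℓ).1)]
  rw [h.sum_ncard_sub_one hG hcl, Finset.sum_const, nsmul_eq_mul] at h1
  exact le_of_mul_le_mul_right h1 hβ

theorem HasClassicalParams.isDelsarteVertex (h : HasClassicalParams G D b α β cc aa bb)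
    (hD : 1 ≤ D) (hlt : ∀ i ≤ D, α * gauss b i < β) (hG : IsPointGraphOf G 𝓛)
    (hcl : ∀ ℓ ∈ 𝓛, G.IsClique ℓ) {x : V} (hx : (lineDegree 𝓛 x : ℝ) = gauss b D) :
    IsDelsarteVertex (𝓛 : Set (Set V)) β x := by
  classical
  have hle : ∀ ℓ ∈ 𝓛.filter (x ∈ ·), ((ℓ.ncard : ℝ) - 1) ≤ β := fun ℓ hℓ => by
    linarith [h.ncard_clique_le hD hlt (hcl ℓ (Finset.mem_filter.1 hℓ).1)]
  have h1 : ∑ ℓ ∈ 𝓛 with x ∈ ℓ, ((ℓ.ncard : ℝ) - 1) = ∑ ℓ ∈ 𝓛 with x ∈ ℓ, β := by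
    rw [h.sum_ncard_sub_one hG hcl, Finset.sum_const, nsmul_eq_mul, ← hx, lineDegree]
  intro ℓ hℓ hxℓ
  have h2 := (Finset.sum_eq_sum_iff_of_le hle).1 h1 ℓ
    (Finset.mem_filter.2 ⟨hℓ, hxℓ⟩)
  linarith

/-- If there are fewer lines than points, then two adjacent vertices lie on exactly `[D]` lines
each. -/
theorem HasClassicalParams.exists_adj_lineDegree_eq
    (h : HasClassicalParams G D b α β cc aa bb) (hD : 1 ≤ D) (hα : 0 ≤ α)
    (hlt : ∀ i ≤ D, α * gauss b i < β) (hG : IsPointGraphOf G 𝓛)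
    (hcl : ∀ ℓ ∈ 𝓛, G.IsClique ℓ) (hcard : 𝓛.card < Fintype.card V) :
    ∃ y z, G.Adj y z ∧ (lineDegree 𝓛 y : ℝ) = gauss b D ∧
      (lineDegree 𝓛 z : ℝ) = gauss b D := by
  classical
  obtain ⟨v, hv, hsum⟩ := exists_ne_zero_sum_line_eq_zero hcard
  have hsq := hG.sum_sq_line_sum hcl v
  rw [Finset.sum_eq_zero fun ℓ hℓ => by rw [hsum ℓ hℓ]; simp] at hsq
  have hquad := h.1.quadratic_form_ge (w := cosineAbs b α β) (r := gauss b D)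
    (by simp [cosineAbs]) (fun i hi => h.cosineAbs_rec hlt hi)
    (fun i hi => cosineAbs_nonneg hα hlt hi) v
  have hnn : ∀ x ∈ Finset.univ, 0 ≤ ((lineDegree 𝓛 x : ℝ) - gauss b D) * v x ^ 2 :=
    fun x _ => mul_nonneg (sub_nonneg.2 (h.gauss_le_lineDegree hD hlt hG hcl x)) (sq_nonneg _)
  have hzero : ∑ x, ((lineDegree 𝓛 x : ℝ) - gauss b D) * v x ^ 2 = 0 := by
    refine le_antisymm ?_ (Finset.sum_nonneg hnn)
    simp only [sub_mul, Finset.sum_sub_distrib, ← Finset.mul_sum]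
    linarith
  have hdeg : ∀ x, v x ≠ 0 → (lineDegree 𝓛 x : ℝ) = gauss b D := by
    intro x hx
    have h1 := (Finset.sum_eq_zero_iff_of_nonneg hnn).1 hzero x (Finset.mem_univ x)
    have h2 := (mul_eq_zero.1 h1).resolve_right (pow_ne_zero 2 hx)
    linarith
  obtain ⟨y, hy⟩ := Function.ne_iff.1 hv
  have hpos : 0 < lineDegree 𝓛 y := by
    have h1 := gauss_mono b hD
    rw [gauss_one] at h1
    have h2 := h1.trans (h.gauss_le_lineDegree hD hlt hG hcl y)
    exact_mod_cast h2
  obtain ⟨ℓ, hℓ⟩ := Finset.card_pos.1 hpos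
  obtain ⟨hℓ, hyℓ⟩ := Finset.mem_filter.1 hℓ
  obtain ⟨z, hzy, hz⟩ : ∃ z, z ≠ y ∧ (if z ∈ ℓ then v z else 0) ≠ 0 := by
    by_contra! hcon
    have h1 := hsum ℓ hℓ
    rw [Finset.sum_eq_single y (fun z _ hzy => hcon z hzy) (by simp), if_pos hyℓ] at h1
    exact hy h1
  have hzℓ : z ∈ ℓ := by
    by_contra hcon
    exact hz (if_neg hcon)
  rw [if_pos hzℓ] at hz
  exact ⟨y, z, hcl ℓ hℓ hyℓ hzℓ hzy.symm, hdeg y hy, hdeg z hz⟩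

/-- Two adjacent Delsarte vertices force `α` to be an integer with `0 ≤ α ≤ b`. -/
theorem HasClassicalParams.exists_alpha_eq_nat (h : HasClassicalParams G D b α β cc aa bb)
    (hD : 2 ≤ D) (hα : 0 ≤ α) (hlt : ∀ i ≤ D, α * gauss b i < β) (hG : IsPointGraphOf G 𝓛)
    (hmax : ∀ ℓ ∈ 𝓛, IsMaxClique G ℓ) {y z : V} (hyz : G.Adj y z)
    (hy : IsDelsarteVertex (𝓛 : Set (Set V)) β y) (hz : IsDelsarteVertex (𝓛 : Set (Set V)) β z)
    (hdeg : 2 ≤ lineDegree 𝓛 z) : ∃ n : ℕ, α = n ∧ n ≤ b := by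
  classical
  have huniq : ∀ {ℓ m : Set V} {p q : V}, ℓ ∈ 𝓛 → m ∈ 𝓛 → p ≠ q → p ∈ ℓ → q ∈ ℓ → p ∈ m →
      q ∈ m → ℓ = m := fun hℓ hm hpq hp hq hp' hq' =>
    (hG _ _ ((hmax _ hℓ).1 hp hq hpq)).unique ⟨hℓ, hp, hq⟩ ⟨hm, hp', hq'⟩
  obtain ⟨ℓ, hℓ, hzℓ, hyℓ⟩ : ∃ ℓ ∈ 𝓛, z ∈ ℓ ∧ y ∉ ℓ := by
    obtain ⟨ℓ₁, h₁, ℓ₂, h₂, hne⟩ := Finset.one_lt_card.1 (show 1 < _ from hdeg)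
    rw [Finset.mem_filter] at h₁ h₂
    by_cases hy₁ : y ∈ ℓ₁
    · exact ⟨ℓ₂, h₂.1, h₂.2, fun hy₂ => hne (huniq h₁.1 h₂.1 hyz.ne hy₁ h₁.2 hy₂ h₂.2)⟩
    · exact ⟨ℓ₁, h₁.1, h₁.2, hy₁⟩
  have hn := h.ncard_adj_of_delsarte (by omega) hlt (hmax ℓ hℓ).1 (hz ℓ hℓ hzℓ) hyℓ hzℓ hyz
  set A : Set V := {w ∈ ℓ | G.Adj y w}
  obtain ⟨n, hA⟩ : ∃ n, A.ncard = n + 1 := by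
    refine Nat.exists_eq_add_one.2 ?_
    rw [Set.ncard_pos]
    exact ⟨z, hzℓ, hyz⟩
  have hαn : α = n := by
    rw [hA] at hn
    push_cast at hn
    linarith
  refine ⟨n, hαn, ?_⟩
  obtain ⟨x, hxℓ, hxy, hnadj⟩ := (hmax ℓ hℓ).exists_not_adj hyℓ
  have hdist : G.dist x y = 2 := by
    have h1 := h.1.1.one_lt_dist_of_ne_of_not_adj hxy fun h' => hnadj h'.symm
    have h2 := h.1.1.dist_triangle (u := x) (v := z) (w := y)
    rw [SimpleGraph.dist_eq_one_iff_adj.2 hyz.symm, SimpleGraph.dist_eq_one_iff_adj.2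
      ((hmax ℓ hℓ).1 hxℓ hzℓ fun h' => hnadj (h' ▸ hyz))] at h2
    omega
  set T : Finset V := {w | G.Adj y w ∧ G.Adj x w}
  have hT : (T.card : ℝ) = (1 + b) * (α + 1) := by
    have h1 := h.cc_eq hD
    rw [gauss_two, Nat.add_one_sub_one, gauss_one, mul_one,
      ← (h.1.2.2.2 2 hD x y hdist).1, Set.ncard_eq_toFinset_card'] at h1
    rw [add_comm α, ← h1]
    congr 2
    ext w
    simp [T]
  have hcount : ∀ m ∈ 𝓛.filter (y ∈ ·), {t ∈ T | t ∈ m}.Nonempty →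
      (({t ∈ T | t ∈ m}.card : ℕ) : ℝ) = α + 1 := by
    rintro m hm ⟨t, ht⟩
    obtain ⟨hm, hym⟩ := Finset.mem_filter.1 hm
    simp only [T, Finset.mem_filter, Finset.mem_univ, true_and] at ht
    have hxm : x ∉ m := fun hxm => hnadj ((hmax m hm).1 hym hxm hxy.symm)
    rw [← h.ncard_adj_of_delsarte (by omega) hlt (hmax m hm).1 (hy m hm hym) hxm ht.2 ht.1.2,
      Set.ncard_eq_toFinset_card']
    congr 2
    ext w
    simp only [T, Finset.mem_filter, Finset.mem_univ, true_and, Set.mem_toFinset,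
      Set.mem_ofPred_eq]
    constructor
    · exact fun hw => ⟨hw.2, hw.1.2⟩
    · exact fun hw => ⟨⟨(hmax m hm).1 hym hw.1 fun h' => hnadj (h' ▸ hw.2.symm), hw.2⟩, hw.1⟩
  set M : Finset (Set V) := {m ∈ 𝓛.filter (y ∈ ·) | {t ∈ T | t ∈ m}.Nonempty}
  have hM : (M.card : ℝ) = 1 + b := by
    have h1 := hG.card_eq_sum (x := y) (T := T) fun t ht => (Finset.mem_filter.1 ht).2.1
    rw [← Finset.sum_filter_of_ne (p := fun m => {t ∈ T | t ∈ m}.Nonempty)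
      fun m _ hm => Finset.card_ne_zero.1 hm] at h1
    have h2 : (T.card : ℝ) = M.card * (α + 1) := by
      rw [h1, Nat.cast_sum, ← nsmul_eq_mul, ← Finset.sum_const]
      exact Finset.sum_congr rfl fun m hm =>
        hcount m (Finset.mem_filter.1 hm).1 (Finset.mem_filter.1 hm).2
    rw [hT] at h2
    exact (mul_right_cancel₀ (by positivity) h2).symm
  have hAM : A.ncard ≤ M.card := by
    have hline : ∀ p ∈ A, ∃ m ∈ 𝓛, y ∈ m ∧ p ∈ m := fun p hp => by
      obtain ⟨m, hm, -⟩ := hG y p hp.2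
      exact ⟨m, hm⟩
    choose! f hf using hline
    rw [← Set.ncard_coe_finset M]
    refine Set.ncard_le_ncard_of_injOn f ?_ ?_
    · intro p hp
      simp only [M, T, Finset.coe_filter, Finset.mem_filter, Set.mem_ofPred_eq]
      refine ⟨⟨(hf p hp).1, (hf p hp).2.1⟩, p, ?_⟩
      simp only [Finset.mem_filter, Finset.mem_univ, true_and]
      exact ⟨⟨hp.2, (hmax ℓ hℓ).1 hxℓ hp.1 fun h' => hnadj (h' ▸ hp.2)⟩, (hf p hp).2.2⟩
    · intro p hp q hq hpq
      by_contra hne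
      have h1 := huniq hℓ (hf p hp).1 hne hp.1 hq.1 (hf p hp).2.2 (hpq ▸ (hf q hq).2.2)
      exact hyℓ (h1 ▸ (hf p hp).2.1)
  have hM' : M.card = 1 + b := by exact_mod_cast hM
  omega

end DelsarteVertices

/-- if `Γ` has classical parameters `(D, b, α, β)`, `b ≥ 2`, `D ≥ 3`, and
`β ≥ (1/3)(8αb + 8b + 5α)r`, then `Γ` has the SPLS(⌊4r/3⌋) property; in particular `α` is an
integer with `0 ≤ α ≤ b`. -/
theorem statement_8 {V : Type*} [Fintype V] (G : SimpleGraph V) (D b : ℕ) (α β : ℝ)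
    (cc aa bb : ℕ → ℕ) (hb : 2 ≤ b) (hD : 3 ≤ D)
    (h : HasClassicalParams G D b α β cc aa bb)
    (hβ : (1 / 3 : ℝ) * (8 * α * (b : ℝ) + 8 * (b : ℝ) + 5 * α) * gauss b D ≤ β) :
    HasSPLS G (aa 1) (cc 2) (Nat.floor (4 * gauss b D / 3)) ∧
    (∃ n : ℕ, α = n ∧ n ≤ b) := by
  classical
  have hα := h.alpha_nonneg hD
  have hlt := fun i hi => alpha_mul_gauss_lt hb hD hα hβ (i := i) hi
  have H := h.largeCliqueHyp hb hD hβ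
  have hb' : (2 : ℝ) ≤ b := by exact_mod_cast hb
  have hr : 3 ≤ gauss b D := by
    have h1 := gauss_mono b (show 2 ≤ D by omega)
    rw [gauss_two] at h1
    linarith
  have hs : 2 ≤ Nat.floor (4 * gauss b D / 3) :=
    Nat.le_floor (by push_cast; linarith)
  refine ⟨H.hasSPLS hs, ?_⟩
  have hc : 2 ≤ cc 2 := by
    have h1 := h.cc_eq (i := 2) (by omega)
    rw [gauss_two, Nat.add_one_sub_one, gauss_one, mul_one] at h1
    have h2 : (2 : ℝ) ≤ cc 2 := by
      rw [h1]
      nlinarith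
    exact_mod_cast h2
  set s := Nat.floor (4 * gauss b D / 3)
  set 𝓛 := (splsLines G (aa 1) (cc 2) s).toFinset
  have hcoe : (𝓛 : Set (Set V)) = splsLines G (aa 1) (cc 2) s := Set.coe_toFinset _
  have hmem : ∀ ℓ, ℓ ∈ 𝓛 ↔ ℓ ∈ splsLines G (aa 1) (cc 2) s := fun ℓ => Set.mem_toFinset
  have hG : IsPointGraphOf G 𝓛 := hcoe ▸ H.existsUnique_line
  have hmax : ∀ ℓ ∈ 𝓛, IsMaxClique G ℓ := fun ℓ hℓ => ((hmem ℓ).1 hℓ).1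
  have hcl : ∀ ℓ ∈ 𝓛, G.IsClique ℓ := fun ℓ hℓ => (hmax ℓ hℓ).1
  have hcard : 𝓛.card < Fintype.card V := by
    have := h.1.1.nonempty
    refine card_lines_lt_card (s := s) (fun x => ?_) fun ℓ hℓ => ?_
    · refine le_of_eq_of_le ?_ (H.ncard_lines_le x)
      rw [Set.ncard_eq_toFinset_card', lineDegree]
      congr 1
      ext ℓ
      simp [hmem]
    · have h1 := ((hmem ℓ).1 hℓ).2
      have h2 := H.lam_bound
      have h3 : (1 : ℤ) ≤ (cc 2 : ℤ) - 1 := by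
        have : (2 : ℤ) ≤ cc 2 := by exact_mod_cast hc
        linarith
      have h4 : (s : ℤ) * 1 ≤ s * ((cc 2 : ℤ) - 1) :=
        mul_le_mul_of_nonneg_left h3 (by positivity)
      have h5 : (s : ℤ) + 1 ≤ ℓ.ncard := by linarith
      exact_mod_cast h5
  obtain ⟨y, z, hyz, hy, hz⟩ :=
    h.exists_adj_lineDegree_eq (by omega) hα hlt hG hcl hcard
  refine h.exists_alpha_eq_nat (by omega) hα hlt hG hmax hyz
    (h.isDelsarteVertex (by omega) hlt hG hcl hy) (h.isDelsarteVertex (by omega) hlt hG hcl hz) ?_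
  have h2 : (2 : ℝ) ≤ lineDegree 𝓛 z := by linarith
  exact_mod_cast h2
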